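/- Let d ≥ 2 and n ≥ 1 be integers and ε ∈ (0,1), and assume n is large enough that 2d · exp( − 6ε²n / (5(d+2)²) ) < 1. Let (x_i)_{i=1}^n be drawn from the uniform measure ν on ℱ_{d,n}^ε, i.e. the n-fold product of the uniform measure on the shell S_ε^d conditioned on the event that (x_1,…,x_n) is ε-nearly Parseval. Then, with probability at least 1 − [ 2d · exp( − n ε⁴ / (2 d³) ) ] / [ 1 − 2d · exp( − 6 ε² n / (5 (d+2)²) ) ], one has inf over (y_i)_{i=1}^n ∈ ℱ_{d,n} of Σ_{i=1}^n ‖x_i − y_i‖² ≤ (sqrt(20) + sqrt(2))² · ε² · d. -/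

import Mathlib

open MeasureTheory ProbabilityTheory Real

noncomputable section

/-- The frame operator `S v = ∑ i, ⟪x i, v⟫ • x i` of a finite family of vectors in `ℝ^d`,
as a continuous linear map on Euclidean space. -/
def frameOperator {d n : ℕ} (x : Fin n → EuclideanSpace ℝ (Fin d)) :
    EuclideanSpace ℝ (Fin d) →L[ℝ] EuclideanSpace ℝ (Fin d) :=
  ∑ i, (innerSL ℝ (x i)).smulRight (x i)

/-- The spherical shell `S_ε^d = {v ∈ ℝ^d : (1-ε)(d/n) ≤ ‖v‖² ≤ (1+ε)(d/n)}`. -/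
def sphericalShell (d n : ℕ) (ε : ℝ) : Set (EuclideanSpace ℝ (Fin d)) :=
  {v | (1 - ε) * ((d : ℝ) / n) ≤ ‖v‖ ^ 2 ∧ ‖v‖ ^ 2 ≤ (1 + ε) * ((d : ℝ) / n)}

/-- The set `ℱ_{d,n}` of equal-norm Parseval frames: `S = I_d` and `‖x_i‖² = d/n`. -/
def equalNormParseval (d n : ℕ) : Set (Fin n → EuclideanSpace ℝ (Fin d)) :=
  {y | frameOperator y = 1 ∧ ∀ i, ‖y i‖ ^ 2 = (d : ℝ) / n}

/-- The squared distance from a frame `x` to the set `ℱ_{d,n}` of equal-norm Parseval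
frames: `inf_{y ∈ ℱ_{d,n}} ∑ i, ‖x_i - y_i‖²`. -/
def paulsenDistSq {d n : ℕ} (x : Fin n → EuclideanSpace ℝ (Fin d)) : ℝ :=
  ⨅ y : equalNormParseval d n, ∑ i, ‖x i - (y : Fin n → EuclideanSpace ℝ (Fin d)) i‖ ^ 2

lemma cosh_norm_add_le {V : Type*} [NormedAddCommGroup V] [InnerProductSpace ℝ V] (a x : V) :
    cosh ‖a + x‖ ≤ cosh ‖a‖ * cosh ‖x‖ +
      (sinh ‖a‖ * sinh ‖x‖ / (‖a‖ * ‖x‖)) * inner ℝ a x := by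
  by_cases ha : a = 0
  · subst ha; simp
  by_cases hx : x = 0
  · subst hx; simp
  have ha' : 0 < ‖a‖ := norm_pos_iff.2 ha
  have hx' : 0 < ‖x‖ := norm_pos_iff.2 hx
  set α := ‖a‖
  set β := ‖x‖
  set c : ℝ := inner ℝ a x / (α * β) with hc
  have hcabs : |c| ≤ 1 := abs_real_inner_div_norm_mul_norm_le_one a x
  obtain ⟨hc1, hc2⟩ := abs_le.1 hcabs
  have hin : inner ℝ a x = c * (α * β) := by rw [hc]; field_simp
  have hn : ‖a + x‖ ^ 2 = (1 + c) / 2 * (α + β) ^ 2 + (1 - c) / 2 * (α - β) ^ 2 := by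
    rw [norm_add_sq_real, hin]; ring
  have key : cosh ‖a + x‖ ≤ (1 + c) / 2 * cosh (α + β) + (1 - c) / 2 * cosh (α - β) := by
    refine hasSum_le (fun k => ?_) (Real.hasSum_cosh _)
      (((Real.hasSum_cosh (α + β)).mul_left ((1 + c) / 2)).add
        ((Real.hasSum_cosh (α - β)).mul_left ((1 - c) / 2)))
    have hcv := (convexOn_pow (𝕜 := ℝ) k).2
    have := @hcv ((α + β) ^ 2) (Set.mem_Ici.2 (sq_nonneg _)) ((α - β) ^ 2)
      (Set.mem_Ici.2 (sq_nonneg _)) ((1 + c) / 2)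
      ((1 - c) / 2) (by linarith) (by linarith) (by ring)
    simp only [smul_eq_mul] at this
    rw [← hn] at this
    simp only [pow_mul]
    rw [← mul_div_assoc, ← mul_div_assoc, ← add_div]
    gcongr
  rw [cosh_add, cosh_sub] at key
  rw [hin]
  have : sinh α * sinh β / (α * β) * (c * (α * β)) = c * (sinh α * sinh β) := by field_simp
  rw [this]
  linarith

abbrev EU (d : ℕ) := EuclideanSpace ℝ (Fin d)

def stdB (d : ℕ) : Module.Basis (Fin d) ℝ (EU d) := (EuclideanSpace.basisFun (Fin d) ℝ).toBasis

/-- Every `d` of the vectors form a basis. -/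
def GenPos {d n : ℕ} (x : Fin n → EU d) : Prop :=
  ∀ f : Fin d → Fin n, Function.Injective f → (stdB d).det (x ∘ f) ≠ 0

lemma hadamard_det {d : ℕ} (v : Fin d → EU d) : |(stdB d).det v| ≤ ∏ i, ‖v i‖ := by
  have : Fact (Module.finrank ℝ (EU d) = d) := ⟨by simp⟩
  have o := (stdB d).orientation
  have := o.abs_volumeForm_apply_le v
  rwa [o.volumeForm_robust' (EuclideanSpace.basisFun (Fin d) ℝ) v] at this

lemma prod_lower {d k : ℕ} (hd : 1 ≤ d) (a : Fin (d + (k + 1)) → ℝ) (ha : ∀ i, 0 ≤ a i) (D c' : ℝ)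
    (hD : 0 ≤ D) (hc' : 0 ≤ c')
    (h1 : ∀ f : Fin d → Fin (d + (k + 1)), Function.Injective f → D ≤ ∏ j, a (f j))
    (h2 : ∃ i, c' ≤ a i) : D ^ (d + k) * c' ^ d ≤ ∏ i, a i ^ d := by
  set σ := Tuple.sort a
  have hmono : Monotone (a ∘ σ) := Tuple.monotone_sort a
  rw [← Equiv.prod_comp σ, Fin.prod_univ_add, Fin.prod_univ_castSucc]
  set p := ∏ j : Fin d, a (σ (Fin.castAdd (k + 1) j)) with hp
  have hDp : D ≤ p := h1 _ (fun i j h => by simpa using h)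
  have hp0 : 0 ≤ p := hD.trans hDp
  have e1 : ∏ i : Fin d, a (σ (Fin.castAdd (k + 1) i)) ^ d = p ^ d := by
    rw [Finset.prod_pow]
  have e2 : p ^ k ≤ ∏ i : Fin k, a (σ (Fin.natAdd d i.castSucc)) ^ d := by
    calc p ^ k = ∏ i : Fin k, p := by simp
      _ ≤ _ := by
        refine Finset.prod_le_prod (fun _ _ => hp0) (fun i _ => ?_)
        calc p ≤ ∏ j : Fin d, a (σ (Fin.natAdd d i.castSucc)) := by
              refine Finset.prod_le_prod (fun _ _ => ha _) (fun j _ => ?_)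
              apply hmono
              rw [Fin.le_def]; simp; omega
          _ = _ := by simp
  have e3 : c' ^ d ≤ a (σ (Fin.natAdd d (Fin.last k))) ^ d := by
    obtain ⟨i, hi⟩ := h2
    refine pow_le_pow_left₀ hc' (hi.trans ?_) d
    have := hmono (a := σ.symm i) (b := Fin.natAdd d (Fin.last k)) (by
      rw [Fin.le_def]; simp; omega)
    simpa using this
  rw [e1, pow_add, mul_assoc]
  have e4 : D ^ k ≤ ∏ i : Fin k, a (σ (Fin.natAdd d i.castSucc)) ^ d :=
    (pow_le_pow_left₀ hD hDp k).trans e2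
  have e5 : 0 ≤ D ^ k := by positivity
  have e6 := e5.trans e4
  gcongr

lemma exists_max {d n : ℕ} (hd : 1 ≤ d) (hn : d + 1 ≤ n) (x : Fin n → EU d) (hx : GenPos x) :
    ∃ B : EU d →L[ℝ] EU d, B.det ≠ 0 ∧ ∀ C : EU d →L[ℝ] EU d,
      |C.det| ^ n * ∏ i, ‖B (x i)‖ ^ d ≤ |B.det| ^ n * ∏ i, ‖C (x i)‖ ^ d := by
  obtain ⟨k, rfl⟩ : ∃ k, n = d + (k + 1) := ⟨n - d - 1, by omega⟩
  have : Nonempty (Fin d) := ⟨⟨0, hd⟩⟩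
  have : Nontrivial (EU d) := inferInstance
  -- lower bound of the determinants
  obtain ⟨c, hc0, hc⟩ : ∃ c > 0, ∀ f : Fin d → Fin (d + (k + 1)), Function.Injective f →
      c ≤ |(stdB d).det (x ∘ f)| := by
    have : Nonempty {f : Fin d → Fin (d + (k + 1)) // Function.Injective f} :=
      ⟨⟨Fin.castAdd _, Fin.castAdd_injective _ _⟩⟩
    obtain ⟨f0, hf0⟩ := Finite.exists_min
      (fun f : {f : Fin d → Fin (d + (k + 1)) // Function.Injective f} => |(stdB d).det (x ∘ f.1)|)
    exact ⟨_, abs_pos.2 (hx f0.1 f0.2), fun f hf => hf0 ⟨f, hf⟩⟩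
  have hdet : ∀ (B : EU d →L[ℝ] EU d) (f : Fin d → Fin (d + (k + 1))), Function.Injective f →
      c * |B.det| ≤ ∏ j, ‖B (x (f j))‖ := by
    intro B f hf
    have := hadamard_det (fun j => B (x (f j)))
    have h2 := (stdB d).det_comp (B : EU d →ₗ[ℝ] EU d) (x ∘ f)
    have h3 : (B : EU d →ₗ[ℝ] EU d) ∘ (x ∘ f) = fun j => B (x (f j)) := rfl
    rw [h3] at h2
    rw [h2, abs_mul] at this
    refine le_trans ?_ this
    rw [mul_comm]
    exact mul_le_mul_of_nonneg_left (hc f hf) (abs_nonneg _)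
  -- norm bound
  obtain ⟨c', hc'0, hc'⟩ : ∃ c' > 0, ∀ B : EU d →L[ℝ] EU d, ‖B‖ = 1 → ∃ i, c' ≤ ‖B (x i)‖ := by
    let φ : (EU d →L[ℝ] EU d) →ₗ[ℝ] (Fin (d + (k + 1)) → EU d) :=
      { toFun := fun B i => B (x i)
        map_add' := fun _ _ => rfl
        map_smul' := fun _ _ => rfl }
    have hφ : LinearMap.ker φ = ⊥ := by
      rw [LinearMap.ker_eq_bot']
      intro B hB
      have hli := (stdB d).isUnit_det
      have h0 := hx (Fin.castAdd _) (Fin.castAdd_injective _ _)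
      have h1 := (Module.Basis.is_basis_iff_det (stdB d)).2 (isUnit_iff_ne_zero.2 h0)
      ext1 v
      have hv : v ∈ Submodule.span ℝ (Set.range (x ∘ Fin.castAdd (k + 1))) := by rw [h1.2]; trivial
      change v ∈ LinearMap.ker (B : EU d →ₗ[ℝ] EU d)
      refine Submodule.span_le.2 ?_ hv
      rintro _ ⟨j, rfl⟩
      exact congrFun hB (Fin.castAdd (k + 1) j)
    obtain ⟨K, hK0, hK⟩ := φ.exists_antilipschitzWith hφ
    refine ⟨1 / (2 * K), by positivity, fun B hB => ?_⟩
    by_contra! hcon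
    have h1 := hK.le_mul_dist B 0
    rw [dist_zero_right, map_zero, dist_zero_right, hB] at h1
    have h2 : ‖φ B‖ ≤ 1 / (2 * K) := (pi_norm_le_iff_of_nonneg (by positivity)).2
      (fun i => (hcon i).le)
    have h3 : (K : ℝ) * ‖φ B‖ ≤ K * (1 / (2 * K)) := by gcongr
    have h4 : (K : ℝ) * (1 / (2 * K)) = 1 / 2 := by
      have : (K : ℝ) ≠ 0 := by exact_mod_cast hK0.ne'
      field_simp
    linarith
  set P : (EU d →L[ℝ] EU d) → ℝ := fun B => ∏ i, ‖B (x i)‖ ^ d with hP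
  set L : ℝ := c ^ (d + k) * c' ^ d with hL
  have hL0 : 0 < L := by positivity
  have hlow : ∀ B : EU d →L[ℝ] EU d, ‖B‖ = 1 → L * |B.det| ^ (d + k) ≤ P B := by
    intro B hB
    have := prod_lower hd (fun i => ‖B (x i)‖) (fun _ => norm_nonneg _) (c * |B.det|) c'
      (by positivity) hc'0.le (hdet B) (hc' B hB)
    rw [mul_pow] at this
    calc _ = c ^ (d + k) * |B.det| ^ (d + k) * c' ^ d := by rw [hL]; ring
      _ ≤ _ := this
  set g : (EU d →L[ℝ] EU d) → ℝ := fun B => |B.det| ^ (d + (k + 1)) / P B with hg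
  have hPnn : ∀ B, 0 ≤ P B := fun B => Finset.prod_nonneg (fun _ _ => by positivity)
  have hPpos : ∀ B : EU d →L[ℝ] EU d, ‖B‖ = 1 → B.det ≠ 0 → 0 < P B := fun B hB h0 =>
    lt_of_lt_of_le (by positivity) (hlow B hB)
  have hgle : ∀ B : EU d →L[ℝ] EU d, ‖B‖ = 1 → B.det ≠ 0 → L * g B ≤ |B.det| := by
    intro B hB h0
    have hp := hPpos B hB h0
    rw [hg, ← mul_div_assoc, div_le_iff₀ hp]
    calc _ = |B.det| * (L * |B.det| ^ (d + k)) := by ring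
      _ ≤ _ := by gcongr; exact hlow B hB
  -- the base point
  set B0 : EU d →L[ℝ] EU d := ContinuousLinearMap.id ℝ (EU d) with hB0
  have hB0n : ‖B0‖ = 1 := ContinuousLinearMap.norm_id
  have hB0d : B0.det = 1 := by
    simp [ContinuousLinearMap.det, hB0]
  set η := L * g B0 with hη
  have hη0 : 0 < η := mul_pos hL0 (div_pos (by rw [hB0d]; simp) (hPpos B0 hB0n (by rw [hB0d]; simp)))
  set K : Set (EU d →L[ℝ] EU d) := Metric.sphere 0 1 ∩ {B | η ≤ |B.det|} with hK
  have hcdet : Continuous (fun B : EU d →L[ℝ] EU d => B.det) := ContinuousLinearMap.continuous_det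
  have hKc : IsCompact K := (isCompact_sphere _ _).inter_right
    (isClosed_le continuous_const hcdet.abs)
  have hKp : ∀ B ∈ K, ‖B‖ = 1 ∧ B.det ≠ 0 := by
    intro B hB
    refine ⟨by simpa using hB.1, fun h => ?_⟩
    have := hB.2
    simp only [Set.mem_ofPred_eq, h, abs_zero] at this
    linarith
  have hB0K : B0 ∈ K := ⟨by simpa using hB0n, hgle B0 hB0n (by rw [hB0d]; simp)⟩
  have hgc : ContinuousOn g K := by
    refine ContinuousOn.div (hcdet.abs.pow _).continuousOn ?_ (fun B hB => (hPpos B (hKp B hB).1 (hKp B hB).2).ne')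
    refine Continuous.continuousOn ?_
    refine continuous_finsetProd _ (fun i _ => ?_)
    exact ((ContinuousLinearMap.apply ℝ (EU d) (x i)).continuous.norm).pow _
  obtain ⟨B, hBK, hBmax⟩ := hKc.exists_isMaxOn ⟨B0, hB0K⟩ hgc
  refine ⟨B, (hKp B hBK).2, fun C => ?_⟩
  have hPB := hPpos B (hKp B hBK).1 (hKp B hBK).2
  by_cases hC : C.det = 0
  · rw [hC, abs_zero, zero_pow (by omega), zero_mul]
    exact mul_nonneg (by positivity) (hPnn C)
  have hC0 : C ≠ 0 := by
    rintro rfl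
    apply hC
    simp [ContinuousLinearMap.det]
  have hCn : 0 < ‖C‖ := norm_pos_iff.2 hC0
  set C1 := ‖C‖⁻¹ • C with hC1
  have hC1n : ‖C1‖ = 1 := by rw [hC1, norm_smul]; simp [hCn.ne']
  have hC1d : C1.det = ‖C‖⁻¹ ^ d * C.det := by
    simp [ContinuousLinearMap.det, hC1, LinearMap.det_smul]
  have hC1d0 : C1.det ≠ 0 := by rw [hC1d]; exact mul_ne_zero (by positivity) hC
  have hg1 : g C1 ≤ g B := by
    by_cases h : η ≤ |C1.det|
    · exact hBmax ⟨by simpa using hC1n, h⟩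
    · push Not at h
      have h1 := hgle C1 hC1n hC1d0
      have h2 : g C1 ≤ g B0 := by
        have : L * g C1 ≤ L * g B0 := h1.trans h.le
        exact le_of_mul_le_mul_left this hL0
      exact h2.trans (hBmax hB0K)
  have hP1 : P C1 = (‖C‖⁻¹ ^ d) ^ (d + (k + 1)) * P C := by
    simp only [hP, hC1, smul_apply, norm_smul, norm_inv, norm_norm, mul_pow]
    rw [Finset.prod_mul_distrib]
    simp
  have hPC1 := hPpos C1 hC1n hC1d0
  simp only [hg] at hg1
  rw [div_le_div_iff₀ hPC1 hPB, hP1, hC1d, abs_mul, mul_pow, abs_of_pos (by positivity : 0 < ‖C‖⁻¹ ^ d)] at hg1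
  have hpos : 0 < (‖C‖⁻¹ ^ d) ^ (d + (k + 1)) := by positivity
  refine le_of_mul_le_mul_left ?_ hpos
  calc _ = (‖C‖⁻¹ ^ d) ^ (d + (k + 1)) * |C.det| ^ (d + (k + 1)) * P B := by ring
    _ ≤ _ := hg1
    _ = _ := by ring

lemma frameOperator_inner {d n : ℕ} (x : Fin n → EU d) (u v : EU d) :
    inner ℝ (frameOperator x u) v = ∑ i, inner ℝ (x i) u * inner ℝ (x i) v := by
  simp [frameOperator, ContinuousLinearMap.sum_apply, sum_inner, inner_smul_left]

lemma frameOperator_symm {d n : ℕ} (x : Fin n → EU d) :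
    ((frameOperator x : EU d →L[ℝ] EU d) : EU d →ₗ[ℝ] EU d).IsSymmetric := by
  intro u v
  change inner ℝ (frameOperator x u) v = inner ℝ u (frameOperator x v)
  rw [frameOperator_inner, real_inner_comm, frameOperator_inner]
  exact Finset.sum_congr rfl (fun i _ => by ring)

lemma frameOperator_eq_one {d n : ℕ} (x : Fin n → EU d)
    (h : ∀ u : EU d, ‖u‖ = 1 → ∑ i, inner ℝ (x i) u ^ 2 = 1) : frameOperator x = 1 := by
  have h' : ∀ u : EU d, ∑ i, inner ℝ (x i) u ^ 2 = ‖u‖ ^ 2 := by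
    intro u
    by_cases hu : u = 0
    · simp [hu]
    have hp : ‖u‖ ≠ 0 := norm_ne_zero_iff.2 hu
    have := h (‖u‖⁻¹ • u) (by rw [norm_smul]; simp [hp])
    simp only [inner_smul_right, mul_pow, ← Finset.mul_sum] at this
    field_simp at this
    linarith
  have hs : ((frameOperator x - 1 : EU d →L[ℝ] EU d) : EU d →ₗ[ℝ] EU d).IsSymmetric := by
    have := (frameOperator_symm x).sub (LinearMap.IsSymmetric.id)
    exact this
  have h0 : ((frameOperator x - 1 : EU d →L[ℝ] EU d) : EU d →ₗ[ℝ] EU d) = 0 := by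
    refine hs.inner_map_self_eq_zero.1 (fun u => ?_)
    change inner ℝ (frameOperator x u - u) u = 0
    rw [inner_sub_left, frameOperator_inner, real_inner_self_eq_norm_sq, ← h' u]
    simp [sq]
  have h1 : frameOperator x - 1 = 0 := by
    ext1 v
    exact LinearMap.congr_fun h0 v
  exact sub_eq_zero.1 h1

lemma first_order {n d : ℕ} (w : Fin n → ℝ)
    (h : ∀ t : ℝ, (1 + t) ^ (2 * n) ≤ ∏ i, (1 + (2 * t + t ^ 2) * w i) ^ d) :
    (d : ℝ) * ∑ i, w i = n := by
  set f : ℝ → ℝ := fun t => ∏ i, (1 + (2 * t + t ^ 2) * w i) ^ d - (1 + t) ^ (2 * n) with hf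
  have hmin : IsLocalMin f 0 := by
    refine Filter.Eventually.of_forall (fun t => ?_)
    have h0 : f 0 = 0 := by simp [hf]
    rw [h0]
    exact sub_nonneg.2 (h t)
  have h1 : ∀ i, HasDerivAt (fun t : ℝ => (1 + (2 * t + t ^ 2) * w i) ^ d) (2 * d * w i) 0 := by
    intro i
    have := ((((hasDerivAt_id (0:ℝ)).const_mul 2).add ((hasDerivAt_id (0:ℝ)).pow 2)).mul_const (w i)).const_add 1 |>.pow d
    refine (this.congr_deriv ?_)
    simp; ring
  have h2 := HasDerivAt.fun_finsetProd (u := Finset.univ) (fun i _ => h1 i)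
  have h3 := ((hasDerivAt_id (0:ℝ)).const_add 1).pow (2 * n)
  have h4 := hmin.hasDerivAt_eq_zero (h2.sub h3)
  simp [← Finset.mul_sum] at h4
  linarith

lemma opt_frame {d n : ℕ} (hd : 1 ≤ d) (hn : 1 ≤ n) (x : Fin n → EU d) (hx : ∀ i, x i ≠ 0)
    (A : EU d →L[ℝ] EU d) (hA : A.det ≠ 0)
    (hopt : ∀ C : EU d →L[ℝ] EU d,
      |C.det| ^ n * ∏ i, ‖A (x i)‖ ^ d ≤ |A.det| ^ n * ∏ i, ‖C (x i)‖ ^ d) :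
    frameOperator (fun i => (√((d:ℝ) / n) / ‖A (x i)‖) • A (x i)) = 1 := by
  have hAx : ∀ i, 0 < ‖A (x i)‖ := by
    intro i
    rw [norm_pos_iff]
    intro h
    have hker := LinearMap.ker_eq_bot'.1 (LinearMap.ker_eq_bot.2
      ((LinearEquiv.ofIsUnitDet (f := (A : EU d →ₗ[ℝ] EU d)) (v := stdB d) (v' := stdB d) (by
        rw [LinearMap.det_toMatrix]; exact isUnit_iff_ne_zero.2 hA)).injective))
    exact hx i (hker _ h)
  apply frameOperator_eq_one
  intro u hu
  have hfo : (d : ℝ) * ∑ i, (inner ℝ (A (x i)) u / ‖A (x i)‖) ^ 2 = n := by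
    apply first_order
    intro t
    let R : EU d →L[ℝ] EU d := ContinuousLinearMap.id ℝ (EU d) + t • (innerSL ℝ u).smulRight u
    have hR : R.det = 1 + t := by
      have h1 : (R : EU d →ₗ[ℝ] EU d) = LinearMap.transvection ((innerSL ℝ u : EU d →L[ℝ] ℝ) : EU d →ₗ[ℝ] ℝ) (t • u) := by
        ext1 v
        simp [R, LinearMap.transvection.apply, smul_smul, mul_comm]
      rw [ContinuousLinearMap.det, h1, LinearMap.transvection.det]
      simp [inner_smul_right, real_inner_self_eq_norm_sq, hu]
    have hRn : ∀ v, ‖R v‖ ^ 2 = ‖v‖ ^ 2 + (2 * t + t ^ 2) * inner ℝ v u ^ 2 := by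
      intro v
      have : R v = v + (t * inner ℝ u v) • u := by simp [R, smul_smul]
      rw [this, norm_add_sq_real, norm_smul, hu, inner_smul_right, real_inner_comm u v]
      simp only [mul_one, Real.norm_eq_abs, sq_abs]
      ring
    have h1 := hopt (R.comp A)
    have hdet : (R.comp A).det = (1 + t) * A.det := by
      rw [← hR]
      exact LinearMap.det_comp _ _
    rw [hdet, abs_mul, mul_pow] at h1
    have hAn : 0 < |A.det| ^ n := by positivity
    have h2 : |1 + t| ^ n * ∏ i, ‖A (x i)‖ ^ d ≤ ∏ i, ‖R (A (x i))‖ ^ d := by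
      refine le_of_mul_le_mul_left ?_ hAn
      calc _ = |1 + t| ^ n * |A.det| ^ n * ∏ i, ‖A (x i)‖ ^ d := by ring
        _ ≤ _ := h1
    have hPn : 0 < ∏ i, ‖A (x i)‖ ^ d := Finset.prod_pos (fun i _ => by have := hAx i; positivity)
    have h3 : |1 + t| ^ n ≤ ∏ i, (‖R (A (x i))‖ / ‖A (x i)‖) ^ d := by
      simp only [div_pow]
      rw [Finset.prod_div_distrib, le_div_iff₀ hPn]
      exact h2
    have h4 := pow_le_pow_left₀ (by positivity) h3 2
    rw [← Finset.prod_pow] at h4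
    calc (1 + t) ^ (2 * n) = (|1 + t| ^ n) ^ 2 := by rw [← pow_mul, mul_comm n 2, pow_mul, pow_mul, sq_abs]
      _ ≤ _ := h4
      _ = _ := by
        refine Finset.prod_congr rfl (fun i _ => ?_)
        rw [← pow_mul, mul_comm d 2, pow_mul, div_pow, hRn]
        congr 1
        have := (hAx i).ne'
        field_simp
  have hn' : (0:ℝ) < n := by exact_mod_cast hn
  have hd' : (0:ℝ) < d := by exact_mod_cast hd
  have hsq : √((d:ℝ) / n) ^ 2 = d / n := Real.sq_sqrt (by positivity)
  calc ∑ i, inner ℝ ((√((d:ℝ) / n) / ‖A (x i)‖) • A (x i)) u ^ 2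
      = ∑ i, (d / n : ℝ) * (inner ℝ (A (x i)) u / ‖A (x i)‖) ^ 2 := by
        refine Finset.sum_congr rfl (fun i _ => ?_)
        rw [inner_smul_left]
        simp only [conj_trivial]
        rw [mul_pow, div_pow, hsq]
        ring
    _ = 1 := by
      rw [← Finset.mul_sum]
      have : ∑ i, (inner ℝ (A (x i)) u / ‖A (x i)‖) ^ 2 = n / d := by
        rw [eq_div_iff hd'.ne']; linarith
      rw [this]; field_simp

lemma exists_scaling {d n : ℕ} (hd : 1 ≤ d) (hn : d + 1 ≤ n) (x : Fin n → EU d) (hx : GenPos x)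
    (hx0 : ∀ i, x i ≠ 0) :
    ∃ (v : OrthonormalBasis (Fin d) ℝ (EU d)) (s : Fin d → ℝ) (z : Fin n → EU d),
      (∀ j, 0 < s j) ∧ (∀ i, z i ≠ 0) ∧ (∀ i j, inner ℝ (v j) (z i) = s j * inner ℝ (v j) (x i)) ∧
      frameOperator (fun i => (√((d:ℝ) / n) / ‖z i‖) • z i) = 1 := by
  obtain ⟨B, hB, hopt⟩ := exists_max hd hn x hx
  have hBinj : ∀ v, B v = 0 → v = 0 := LinearMap.ker_eq_bot'.1 (LinearMap.ker_eq_bot.2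
      ((LinearEquiv.ofIsUnitDet (f := (B : EU d →ₗ[ℝ] EU d)) (v := stdB d) (v' := stdB d) (by
        rw [LinearMap.det_toMatrix]; exact isUnit_iff_ne_zero.2 hB)).injective))
  set T : EU d →L[ℝ] EU d := B.adjoint.comp B with hT
  have hTin : ∀ u v, inner ℝ (T u) v = inner ℝ (B u) (B v) := by
    intro u v
    simp [hT, ContinuousLinearMap.adjoint_inner_left]
  have hsym : (T : EU d →ₗ[ℝ] EU d).IsSymmetric := by
    intro u v
    change inner ℝ (T u) v = inner ℝ u (T v)
    rw [hTin, real_inner_comm (T v) u, hTin, real_inner_comm]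
  have hfr : Module.finrank ℝ (EU d) = d := by simp
  set v := hsym.eigenvectorBasis hfr with hv
  set l := hsym.eigenvalues hfr with hl
  have hTv : ∀ j, T (v j) = l j • v j := fun j => hsym.apply_eigenvectorBasis hfr j
  have hlpos : ∀ j, 0 < l j := by
    intro j
    have h1 := hTin (v j) (v j)
    rw [hTv, inner_smul_left, real_inner_self_eq_norm_sq, real_inner_self_eq_norm_sq, v.norm_eq_one] at h1
    have h2 : B (v j) ≠ 0 := fun h => by
      have := hBinj _ h
      have h3 := v.norm_eq_one j
      rw [this] at h3; simp at h3
    have : 0 < ‖B (v j)‖ := norm_pos_iff.2 h2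
    simp at h1
    rw [h1]; positivity
  set s : Fin d → ℝ := fun j => √(l j) with hs
  have hspos : ∀ j, 0 < s j := fun j => Real.sqrt_pos.2 (hlpos j)
  let A : EU d →L[ℝ] EU d := ∑ j, s j • (innerSL ℝ (v j)).smulRight (v j)
  have hAv : ∀ y, A y = ∑ j, (s j * inner ℝ (v j) y) • v j := by
    intro y; simp [A, ContinuousLinearMap.sum_apply, smul_smul]
  have hAin : ∀ y j, inner ℝ (v j) (A y) = s j * inner ℝ (v j) y := by
    intro y j
    rw [hAv, v.orthonormal.inner_right_fintype]
  have hAA : ∀ y, A (A y) = T y := by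
    intro y
    refine v.repr.injective ?_
    ext j
    rw [v.repr_apply_apply, v.repr_apply_apply, hAin, hAin]
    have h1 : inner ℝ (v j) (T y) = l j * inner ℝ (v j) y := by
      have h2 : inner ℝ (T (v j)) y = inner ℝ (v j) (T y) := hsym (v j) y
      rw [← h2, hTv, inner_smul_left]
      rfl
    rw [h1, ← mul_assoc, hs]
    simp only [Real.mul_self_sqrt (hlpos j).le]
  have hAn : ∀ y, ‖A y‖ = ‖B y‖ := by
    intro y
    have h1 : ‖A y‖ ^ 2 = ‖B y‖ ^ 2 := by
      rw [← real_inner_self_eq_norm_sq (B y), ← hTin, ← hAA, ← v.sum_inner_mul_inner,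
        ← real_inner_self_eq_norm_sq, ← v.sum_inner_mul_inner (A y)]
      refine Finset.sum_congr rfl (fun j _ => ?_)
      simp only [real_inner_comm (v j) (A (A y)), real_inner_comm (v j) (A y), hAin]
      ring
    exact (pow_left_inj₀ (norm_nonneg _) (norm_nonneg _) two_ne_zero).1 h1
  have hdet : |A.det| = |B.det| := by
    have h1 : A.det * A.det = T.det := by
      have : A.comp A = T := ContinuousLinearMap.ext hAA
      rw [← this]; exact (LinearMap.det_comp _ _).symm
    have h2 : T.det = B.det * B.det := by
      have h3 : T.det = B.adjoint.det * B.det := LinearMap.det_comp _ _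
      have h4 : B.adjoint.det = B.det := by
        have h5 := LinearMap.toMatrix_adjoint v v (B : EU d →ₗ[ℝ] EU d)
        have h6 := congrArg Matrix.det h5
        rw [Matrix.det_conjTranspose, LinearMap.det_toMatrix, LinearMap.det_toMatrix] at h6
        have h7 : ((ContinuousLinearMap.adjoint B : EU d →L[ℝ] EU d) : EU d →ₗ[ℝ] EU d) =
            LinearMap.adjoint (B : EU d →ₗ[ℝ] EU d) := by
          rw [LinearMap.eq_adjoint_iff]
          intro p q
          exact ContinuousLinearMap.adjoint_inner_left B q p
        change LinearMap.det _ = LinearMap.det _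
        rw [h7]
        simpa using h6
      rw [h3, h4]
    rw [← sq_eq_sq_iff_abs_eq_abs, sq, sq, h1, h2]
  have hA0 : A.det ≠ 0 := by
    rw [← abs_pos, hdet, abs_pos]; exact hB
  refine ⟨v, s, fun i => A (x i), hspos, fun i h => ?_, fun i j => hAin _ _, ?_⟩
  · have h1 : ‖B (x i)‖ = 0 := by
      have h' : A (x i) = 0 := h
      rw [← hAn, h', norm_zero]
    exact hx0 i (hBinj _ (norm_eq_zero.1 h1))
  · refine opt_frame hd (by omega) x hx0 A hA0 (fun C => ?_)
    simp only [hAn, hdet]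
    exact hopt C

lemma tv_le {d : ℕ} (p s : Fin d → ℝ) (Z : ℝ) (hp : ∀ j, 0 ≤ p j) (hs : ∀ j, 0 < s j)
    (hZ : 0 < Z) (hp1 : ∑ j, p j = 1) (hq1 : ∑ j, s j ^ 2 * p j / Z = 1) :
    ∑ j, |p j - s j ^ 2 * p j / Z| ≤
      2 * ∑ j0, ∑ j with s j0 ≤ s j, (s j ^ 2 * p j / Z - p j) := by
  set q : Fin d → ℝ := fun j => s j ^ 2 * p j / Z with hq
  have hge : ∀ j, Z ≤ s j ^ 2 → p j ≤ q j := by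
    intro j h
    simp only [hq]
    rw [le_div_iff₀ hZ]
    nlinarith [hp j]
  have hle : ∀ j, s j ^ 2 ≤ Z → q j ≤ p j := by
    intro j h
    simp only [hq]
    rw [div_le_iff₀ hZ]
    nlinarith [hp j]
  have h0 : ∑ j, (q j - p j) = 0 := by
    rw [Finset.sum_sub_distrib, hp1, hq1]; ring
  have hD : ∀ j0, 0 ≤ ∑ j with s j0 ≤ s j, (q j - p j) := by
    intro j0
    rcases le_total Z (s j0 ^ 2) with h | h
    · refine Finset.sum_nonneg (fun j hj => ?_)
      have h1 : s j0 ≤ s j := (Finset.mem_filter.1 hj).2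
      have h2 : s j0 ^ 2 ≤ s j ^ 2 := pow_le_pow_left₀ (hs j0).le h1 2
      linarith [hge j (h.trans h2)]
    · rw [← Finset.sum_filter_add_sum_filter_not Finset.univ (fun j => s j0 ≤ s j)] at h0
      have : ∑ j with ¬ s j0 ≤ s j, (q j - p j) ≤ 0 := by
        refine Finset.sum_nonpos (fun j hj => ?_)
        have h1 : ¬ s j0 ≤ s j := (Finset.mem_filter.1 hj).2
        have h2 : s j ^ 2 ≤ s j0 ^ 2 := pow_le_pow_left₀ (hs j).le (not_le.1 h1).le 2
        linarith [hle j (h2.trans h)]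
      linarith
  have htv : ∑ j, |p j - q j| = 2 * ∑ j with Z ≤ s j ^ 2, (q j - p j) := by
    have h1 : ∑ j with Z ≤ s j ^ 2, |p j - q j| = ∑ j with Z ≤ s j ^ 2, (q j - p j) := by
      refine Finset.sum_congr rfl (fun j hj => ?_)
      rw [abs_sub_comm, abs_of_nonneg (by linarith [hge j (Finset.mem_filter.1 hj).2])]
    have h2 : ∑ j with ¬ Z ≤ s j ^ 2, |p j - q j| = - ∑ j with ¬ Z ≤ s j ^ 2, (q j - p j) := by
      rw [← Finset.sum_neg_distrib]
      refine Finset.sum_congr rfl (fun j hj => ?_)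
      rw [abs_of_nonneg (by linarith [hle j (not_le.1 (Finset.mem_filter.1 hj).2).le])]
      ring
    rw [← Finset.sum_filter_add_sum_filter_not Finset.univ (fun j => Z ≤ s j ^ 2)] at h0 ⊢
    rw [h1, h2]; linarith
  rw [htv]
  have : ∑ j with Z ≤ s j ^ 2, (q j - p j) ≤ ∑ j0, ∑ j with s j0 ≤ s j, (q j - p j) := by
    rcases (Finset.univ.filter (fun j => Z ≤ s j ^ 2)).eq_empty_or_nonempty with h | h
    · rw [h, Finset.sum_empty]
      exact Finset.sum_nonneg (fun j0 _ => hD j0)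
    · obtain ⟨j0, hj0, hmin⟩ := Finset.exists_min_image _ s h
      have h1 : (Finset.univ.filter (fun j => Z ≤ s j ^ 2)) =
          Finset.univ.filter (fun j => s j0 ≤ s j) := by
        ext j
        simp only [Finset.mem_filter, Finset.mem_univ, true_and]
        constructor
        · intro hj; exact hmin j (by simpa using hj)
        · intro hj
          have := (Finset.mem_filter.1 hj0).2
          exact this.trans (pow_le_pow_left₀ (hs j0).le hj 2)
      rw [h1]
      exact Finset.single_le_sum (f := fun j0 => ∑ j with s j0 ≤ s j, (q j - p j))
        (fun j0 _ => hD j0) (Finset.mem_univ j0)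
  linarith

abbrev VV (d : ℕ) := EuclideanSpace ℝ (Fin d × Fin d)

def QQ {d : ℕ} (x : EU d) : VV d := WithLp.toLp 2 (fun p => x p.1 * x p.2)

def IV (d : ℕ) : VV d := WithLp.toLp 2 (fun p => if p.1 = p.2 then 1 else 0)

def XV (d n : ℕ) (x : EU d) : VV d := ((d : ℝ) / n / ‖x‖ ^ 2) • QQ x - (1 / (n : ℝ)) • IV d

lemma eu_inner {d : ℕ} (x y : EU d) : inner ℝ x y = ∑ a, x a * y a := by
  rw [PiLp.inner_apply]
  refine Finset.sum_congr rfl (fun a _ => ?_)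
  simp [mul_comm]

lemma vv_inner {d : ℕ} (x y : VV d) : inner ℝ x y = ∑ a, ∑ b, x (a, b) * y (a, b) := by
  rw [PiLp.inner_apply, Fintype.sum_prod_type]
  refine Finset.sum_congr rfl (fun a _ => Finset.sum_congr rfl (fun b _ => ?_))
  simp [mul_comm]

lemma QQ_inner {d : ℕ} (x y : EU d) : inner ℝ (QQ x) (QQ y) = inner ℝ x y ^ 2 := by
  rw [vv_inner, eu_inner, sq, Finset.sum_mul_sum]
  refine Finset.sum_congr rfl (fun a _ => Finset.sum_congr rfl (fun b _ => ?_))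
  simp [QQ]; ring

lemma IV_inner {d : ℕ} (y : EU d) : inner ℝ (IV d) (QQ y) = ‖y‖ ^ 2 := by
  rw [vv_inner, ← real_inner_self_eq_norm_sq, eu_inner]
  refine Finset.sum_congr rfl (fun a _ => ?_)
  simp [QQ, IV]

lemma IV_self {d : ℕ} : inner ℝ (IV d) (IV d) = (d : ℝ) := by
  rw [vv_inner]; simp [IV]

lemma XV_inner {d n : ℕ} (x y : EU d) :
    inner ℝ (XV d n x) (QQ y) = (d : ℝ) / n / ‖x‖ ^ 2 * inner ℝ x y ^ 2 - 1 / n * ‖y‖ ^ 2 := by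
  rw [XV, inner_sub_left, inner_smul_left, inner_smul_left, QQ_inner, IV_inner]; rfl

lemma XV_norm {d n : ℕ} (x : EU d) (hx : x ≠ 0) :
    ‖XV d n x‖ = √((d : ℝ) * (d - 1)) / (n : ℝ) := by
  have h0 : 0 < ‖x‖ := norm_pos_iff.2 hx
  have hd : 1 ≤ d := by
    rcases Nat.eq_zero_or_pos d with h | h
    · subst h; exact absurd (Subsingleton.elim x 0) hx
    · exact h
  have hd' : (1:ℝ) ≤ d := by exact_mod_cast hd
  have h1 : ‖XV d n x‖ ^ 2 = (√((d : ℝ) * (d - 1)) / (n : ℝ)) ^ 2 := by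
    rw [← real_inner_self_eq_norm_sq]
    have : inner ℝ (XV d n x) (XV d n x) = inner ℝ (XV d n x) (((d : ℝ) / n / ‖x‖ ^ 2) • QQ x)
       - inner ℝ (XV d n x) ((1 / (n : ℝ)) • IV d) := by
      rw [← inner_sub_right]; rfl
    rw [this, inner_smul_right, inner_smul_right, XV_inner, real_inner_comm (IV d) (XV d n x), XV, inner_sub_right,
      inner_smul_right, inner_smul_right, IV_inner, IV_self, real_inner_self_eq_norm_sq,
      div_pow, Real.sq_sqrt (by nlinarith)]
    field_simp
    ring
  exact (pow_left_inj₀ (norm_nonneg _) (by positivity) two_ne_zero).1 h1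

lemma QQ_sum_norm {d : ℕ} (v : OrthonormalBasis (Fin d) ℝ (EU d)) (U : Finset (Fin d)) :
    ‖∑ j ∈ U, QQ (v j)‖ ≤ √d := by
  apply Real.le_sqrt_of_sq_le
  rw [← real_inner_self_eq_norm_sq, sum_inner]
  simp only [inner_sum, QQ_inner, orthonormal_iff_ite.1 v.orthonormal]
  simp only [ite_pow, one_pow, ne_eq, OfNat.ofNat_ne_zero, not_false_eq_true, zero_pow,
    Finset.sum_ite_eq]
  rw [Finset.sum_ite_mem]
  simp only [Finset.inter_self, Finset.sum_const, nsmul_eq_mul, mul_one]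
  exact_mod_cast (Finset.card_le_univ U).trans (by simp)

lemma sq_sub_le_abs (a b : ℝ) (h : 0 ≤ a * b) : (a - b) ^ 2 ≤ |a ^ 2 - b ^ 2| := by
  rcases le_total (b^2) (a^2) with h1 | h1
  · rw [abs_of_nonneg (by linarith)]
    nlinarith [abs_mul_abs_self b, abs_mul_abs_self a, abs_mul a b, abs_of_nonneg h, sq_le_sq.1 h1, abs_nonneg a, abs_nonneg b]
  · rw [abs_of_nonpos (by linarith)]
    nlinarith [abs_mul_abs_self b, abs_mul_abs_self a, abs_mul a b, abs_of_nonneg h, sq_le_sq.1 h1, abs_nonneg a, abs_nonneg b]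

lemma dist_scaling {d n : ℕ} (hd : 1 ≤ d) (hn : d + 1 ≤ n) (x : Fin n → EU d) (hx : GenPos x)
    (hx0 : ∀ i, x i ≠ 0) :
    ∃ y ∈ equalNormParseval d n,
      ∑ i, ‖(√((d:ℝ) / n) / ‖x i‖) • x i - y i‖ ^ 2 ≤ 2 * d * √d * ‖∑ i, XV d n (x i)‖ := by
  obtain ⟨v, s, z, hs, hz, hvz, hS⟩ := exists_scaling hd hn x hx hx0
  have hn0 : (0:ℝ) < n := by exact_mod_cast (by omega : 0 < n)
  have hd0 : (0:ℝ) < d := by exact_mod_cast (by omega : 0 < d)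
  set c : ℝ := (d:ℝ)/n with hc
  have hc0 : 0 < c := by positivity
  set y : Fin n → EU d := fun i => (√c / ‖z i‖) • z i with hy
  have hxn : ∀ i, 0 < ‖x i‖ := fun i => norm_pos_iff.2 (hx0 i)
  have hzn : ∀ i, 0 < ‖z i‖ := fun i => norm_pos_iff.2 (hz i)
  refine ⟨y, ⟨hS, fun i => ?_⟩, ?_⟩
  · simp only [hy]
    rw [norm_smul, Real.norm_eq_abs, abs_of_nonneg (by positivity), div_mul_cancel₀ _ (hzn i).ne',
      Real.sq_sqrt hc0.le]
  set p : Fin n → Fin d → ℝ := fun i j => inner ℝ (v j) (x i) ^ 2 / ‖x i‖ ^ 2 with hp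
  set Z : Fin n → ℝ := fun i => ‖z i‖ ^ 2 / ‖x i‖ ^ 2 with hZ
  have hq : ∀ i j, s j ^ 2 * p i j / Z i = inner ℝ (v j) (z i) ^ 2 / ‖z i‖ ^ 2 := by
    intro i j
    rw [hvz]; simp only [hp, hZ]
    have := (hxn i).ne'; have := (hzn i).ne'
    field_simp
  have hpar : ∀ w : EU d, ∑ j, inner ℝ (v j) w ^ 2 = ‖w‖ ^ 2 := by
    intro w
    rw [← v.sum_sq_norm_inner_right w]
    simp
  have hbound : ∀ i, ‖(√c / ‖x i‖) • x i - y i‖ ^ 2 ≤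
      c * (2 * ∑ j0, ∑ j with s j0 ≤ s j, (s j ^ 2 * p i j / Z i - p i j)) := by
    intro i
    have h1 := tv_le (p i) s (Z i) (fun j => by positivity) hs (div_pos (pow_pos (hzn i) 2) (pow_pos (hxn i) 2)) (by
      simp only [hp]; rw [← Finset.sum_div, hpar, div_self (pow_pos (hxn i) 2).ne']) (by
      simp only [hq]; rw [← Finset.sum_div, hpar, div_self (pow_pos (hzn i) 2).ne'])
    refine le_trans ?_ (mul_le_mul_of_nonneg_left h1 hc0.le)
    rw [← hpar, Finset.mul_sum]
    refine Finset.sum_le_sum (fun j _ => ?_)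
    rw [hq]
    simp only [hp, hy]
    rw [inner_sub_right, inner_smul_right, inner_smul_right]
    have h2 := sq_sub_le_abs (inner ℝ (v j) (x i) / ‖x i‖) (inner ℝ (v j) (z i) / ‖z i‖) (by
      rw [hvz]
      have e : inner ℝ (v j) (x i) / ‖x i‖ * (s j * inner ℝ (v j) (x i) / ‖z i‖) =
        s j * inner ℝ (v j) (x i) ^ 2 / (‖x i‖ * ‖z i‖) := by
          have := (hxn i).ne'; have := (hzn i).ne'
          field_simp
      rw [e]
      have := hs j; have := hxn i; have := hzn i
      positivity)
    rw [div_pow, div_pow] at h2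
    refine le_trans (le_of_eq ?_) (mul_le_mul_of_nonneg_left h2 hc0.le)
    have : √c / ‖x i‖ * inner ℝ (v j) (x i) - √c / ‖z i‖ * inner ℝ (v j) (z i) =
      √c * (inner ℝ (v j) (x i) / ‖x i‖ - inner ℝ (v j) (z i) / ‖z i‖) := by ring
    rw [this, mul_pow, Real.sq_sqrt hc0.le]
  refine (Finset.sum_le_sum (fun i _ => hbound i)).trans ?_
  have hkey : ∀ j, ∑ i, c * (s j ^ 2 * p i j / Z i - p i j) =
      - inner ℝ (∑ i, XV d n (x i)) (QQ (v j)) := by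
    intro j
    have hone : ∑ i, c * (s j ^ 2 * p i j / Z i) = 1 := by
      have h1 := frameOperator_inner y (v j) (v j)
      rw [hS] at h1
      have h2 : inner ℝ ((1 : EU d →L[ℝ] EU d) (v j)) (v j) = 1 := by
        simp
      have h3 : ∑ i, c * (s j ^ 2 * p i j / Z i) = ∑ i, inner ℝ (y i) (v j) ^ 2 := by
        refine Finset.sum_congr rfl (fun i _ => ?_)
        rw [hq]; simp only [hy]
        rw [inner_smul_left, real_inner_comm (v j) (z i)]
        simp only [conj_trivial]
        rw [mul_pow, div_pow, Real.sq_sqrt hc0.le]; ring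
      rw [h3, ← h2, h1]
      exact Finset.sum_congr rfl (fun i _ => by ring)
    simp only [mul_sub]
    rw [Finset.sum_sub_distrib, hone, sum_inner]
    simp only [XV_inner, v.norm_eq_one]
    rw [Finset.sum_sub_distrib]
    simp only [Finset.sum_const, Finset.card_univ, Fintype.card_fin, nsmul_eq_mul]
    rw [show (n:ℝ) * (1 / n * 1 ^ 2) = 1 by field_simp]
    have : ∀ i, c * p i j = c / ‖x i‖ ^ 2 * inner ℝ (x i) (v j) ^ 2 := by
      intro i
      simp only [hp]; rw [real_inner_comm (v j) (x i)]; ring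
    simp only [this]
    ring
  have hU : ∀ j0, ∑ j with s j0 ≤ s j, ∑ i, c * (s j ^ 2 * p i j / Z i - p i j) ≤
      √d * ‖∑ i, XV d n (x i)‖ := by
    intro j0
    simp only [hkey]
    rw [Finset.sum_neg_distrib, ← inner_sum]
    refine (neg_le_abs _).trans ((abs_real_inner_le_norm _ _).trans ?_)
    rw [mul_comm]
    exact mul_le_mul_of_nonneg_right (QQ_sum_norm v _) (norm_nonneg _)
  calc ∑ i, c * (2 * ∑ j0, ∑ j with s j0 ≤ s j, (s j ^ 2 * p i j / Z i - p i j))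
      = 2 * ∑ j0, ∑ j with s j0 ≤ s j, ∑ i, c * (s j ^ 2 * p i j / Z i - p i j) := by
        simp only [Finset.mul_sum]
        rw [Finset.sum_comm]
        refine Finset.sum_congr rfl (fun j0 _ => ?_)
        rw [Finset.sum_comm]
        refine Finset.sum_congr rfl (fun j _ => Finset.sum_congr rfl (fun i _ => ?_))
        ring
    _ ≤ 2 * ∑ j0 : Fin d, √d * ‖∑ i, XV d n (x i)‖ := by
        gcongr with j0 _
        exact hU j0
    _ = _ := by simp; ring

section Pinelis
variable {E V : Type*} [MeasurableSpace E] [NormedAddCommGroup V] [InnerProductSpace ℝ V]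
  [MeasurableSpace V] [BorelSpace V] [SecondCountableTopology V]

lemma cosh_sum_integrable {n : ℕ} (P : Measure (Fin n → E)) [IsFiniteMeasure P] (f : E → V)
    (hf : Measurable f) (R : ℝ) (hR : ∀ x, ‖f x‖ ≤ R) (a : V) :
    Integrable (fun x => cosh ‖a + ∑ i, f (x i)‖) P := by
  have hm : Measurable (fun x : Fin n → E => cosh ‖a + ∑ i, f (x i)‖) := by
    refine Real.continuous_cosh.measurable.comp (Measurable.norm ?_)
    exact measurable_const.add (Finset.measurable_fun_sum _ (fun i _ => hf.comp (measurable_pi_apply i)))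
  refine Integrable.of_bound hm.aestronglyMeasurable (cosh (‖a‖ + n * R)) (Filter.Eventually.of_forall ?_)
  intro x
  rw [Real.norm_eq_abs, abs_of_pos (cosh_pos _)]
  rw [Real.cosh_le_cosh, abs_of_nonneg (norm_nonneg _)]
  refine le_trans ?_ (le_abs_self _)
  refine (norm_add_le _ _).trans (add_le_add le_rfl ((norm_sum_le _ _).trans ?_))
  refine (Finset.sum_le_sum (fun i _ => hR (x i))).trans ?_
  simp

lemma pinelis_step (μ : Measure E) [IsProbabilityMeasure μ] (f : E → V)
    (hf : Measurable f) (R : ℝ) (hR : ∀ x, ‖f x‖ ≤ R) (hR' : ∀ᵐ x ∂μ, ‖f x‖ = R)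
    (h0 : ∀ a : V, ∫ x, inner ℝ a (f x) ∂μ = 0) (a : V) :
    ∫ x, cosh ‖a + f x‖ ∂μ ≤ cosh ‖a‖ * cosh R := by
  have hInt0 : Integrable (fun x => inner ℝ a (f x)) μ := by
    refine Integrable.of_bound (measurable_const.inner hf).aestronglyMeasurable (‖a‖ * R)
      (Filter.Eventually.of_forall (fun x => ?_))
    exact (norm_inner_le_norm _ _).trans (mul_le_mul_of_nonneg_left (hR x) (norm_nonneg _))
  have h1 : ∫ x, cosh ‖a + f x‖ ∂μ ≤
      ∫ x, (cosh ‖a‖ * cosh R + sinh ‖a‖ * sinh R / (‖a‖ * R) * inner ℝ a (f x)) ∂μ := by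
    refine integral_mono_ae ?_ ((integrable_const _).add (hInt0.const_mul _)) ?_
    · have hm : Measurable (fun x : E => cosh ‖a + f x‖) :=
        Real.continuous_cosh.measurable.comp (measurable_const.add hf).norm
      refine Integrable.of_bound hm.aestronglyMeasurable (cosh (‖a‖ + R)) (Filter.Eventually.of_forall ?_)
      intro x
      rw [Real.norm_eq_abs, abs_of_pos (cosh_pos _), Real.cosh_le_cosh, abs_of_nonneg (norm_nonneg _)]
      exact ((norm_add_le _ _).trans (add_le_add le_rfl (hR x))).trans (le_abs_self _)
    · filter_upwards [hR'] with x hx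
      have := cosh_norm_add_le a (f x)
      rwa [hx] at this
  refine h1.trans (le_of_eq ?_)
  rw [integral_add (integrable_const _) (hInt0.const_mul _), integral_const_mul (sinh ‖a‖ * sinh R / (‖a‖ * R)), h0]
  simp

lemma pinelis (μ : Measure E) [IsProbabilityMeasure μ] (f : E → V)
    (hf : Measurable f) (R : ℝ) (hR : ∀ x, ‖f x‖ ≤ R) (hR' : ∀ᵐ x ∂μ, ‖f x‖ = R)
    (h0 : ∀ a : V, ∫ x, inner ℝ a (f x) ∂μ = 0) (n : ℕ) : ∀ a : V,
    ∫ x, cosh ‖a + ∑ i, f (x i)‖ ∂(Measure.pi fun _ : Fin n => μ) ≤ cosh ‖a‖ * cosh R ^ n := by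
  induction n with
  | zero => intro a; simp
  | succ n ih =>
    intro a
    have hmp := (measurePreserving_piFinSuccAbove (fun _ : Fin (n+1) => μ) 0).symm
    rw [← hmp.integral_comp']
    have hI := cosh_sum_integrable (Measure.pi fun _ : Fin (n+1) => μ) f hf R hR a
    have hI2 := (hmp.integrable_comp_emb (MeasurableEquiv.measurableEmbedding _)).2 hI
    simp only [Function.comp_def] at hI2
    rw [integral_prod _ hI2]
    simp only [MeasurableEquiv.piFinSuccAbove_symm_apply, Fin.insertNthEquiv, Equiv.coe_fn_mk,
      Fin.insertNth_zero, Fin.sum_univ_succ, Fin.cons_zero, Fin.cons_succ, ← add_assoc]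
    have h1 : ∀ x : E, ∫ y, cosh ‖a + f x + ∑ i, f (y i)‖ ∂(Measure.pi fun _ : Fin n => μ) ≤
      cosh ‖a + f x‖ * cosh R ^ n := fun x => ih (a + f x)
    have hm : Measurable (fun x : E => cosh ‖a + f x‖) :=
        Real.continuous_cosh.measurable.comp (measurable_const.add hf).norm
    have hi : Integrable (fun x : E => cosh ‖a + f x‖) μ := by
      refine Integrable.of_bound hm.aestronglyMeasurable (cosh (‖a‖ + R)) (Filter.Eventually.of_forall ?_)
      intro x
      rw [Real.norm_eq_abs, abs_of_pos (cosh_pos _), Real.cosh_le_cosh, abs_of_nonneg (norm_nonneg _)]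
      exact ((norm_add_le _ _).trans (add_le_add le_rfl (hR x))).trans (le_abs_self _)
    refine (integral_mono_of_nonneg (Filter.Eventually.of_forall (fun x =>
      integral_nonneg (fun y => (cosh_pos _).le))) (hi.mul_const _) (Filter.Eventually.of_forall h1)).trans ?_
    rw [integral_mul_const, pow_succ]
    have := pinelis_step μ f hf R hR hR' h0 a
    have hc : 0 ≤ cosh R ^ n := (pow_pos (cosh_pos _) _).le
    nlinarith

lemma pinelis_tail (μ : Measure E) [IsProbabilityMeasure μ] (f : E → V)
    (hf : Measurable f) (R : ℝ) (hR : ∀ x, ‖f x‖ ≤ R) (hR' : ∀ᵐ x ∂μ, ‖f x‖ = R)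
    (h0 : ∀ a : V, ∫ x, inner ℝ a (f x) ∂μ = 0) (n : ℕ) (l t : ℝ) (hl : 0 < l) (ht : 0 ≤ t) :
    (Measure.pi fun _ : Fin n => μ).real {x | t ≤ ‖∑ i, f (x i)‖} ≤
      2 * exp (n * (l * R) ^ 2 / 2 - l * t) := by
  set P := Measure.pi fun _ : Fin n => μ
  have hp := pinelis μ (fun x => l • f x) (hf.const_smul l) (l * R)
    (fun x => by rw [norm_smul, Real.norm_eq_abs, abs_of_pos hl]; exact mul_le_mul_of_nonneg_left (hR x) hl.le)
    (by filter_upwards [hR'] with x hx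
        rw [norm_smul, Real.norm_eq_abs, abs_of_pos hl, hx])
    (fun a => by simp only [inner_smul_right]; rw [integral_const_mul, h0, mul_zero]) n 0
  have hI := cosh_sum_integrable P (fun x => l • f x) (hf.const_smul l) (l * R)
    (fun x => by rw [norm_smul, Real.norm_eq_abs, abs_of_pos hl]; exact mul_le_mul_of_nonneg_left (hR x) hl.le) 0
  have hM := mul_meas_ge_le_integral_of_nonneg (Filter.Eventually.of_forall (fun x => (cosh_pos _).le)) hI (cosh (l * t))
  have hsub : P.real {x | t ≤ ‖∑ i, f (x i)‖} ≤
      P.real {x | cosh (l * t) ≤ cosh ‖(0:V) + ∑ i, l • f (x i)‖} := by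
    refine measureReal_mono (fun x hx => ?_)
    simp only [Set.mem_ofPred_eq] at hx ⊢
    rw [Real.cosh_le_cosh, zero_add, ← Finset.smul_sum, norm_smul, Real.norm_eq_abs, abs_of_pos hl,
      abs_of_nonneg (by positivity), abs_of_nonneg (by positivity)]
    exact mul_le_mul_of_nonneg_left hx hl.le
  have h2 : cosh (l * R) ^ n ≤ exp (n * (l * R) ^ 2 / 2) := by
    refine (pow_le_pow_left₀ (cosh_pos _).le (cosh_le_exp_half_sq _) n).trans (le_of_eq ?_)
    rw [← Real.exp_nat_mul]; congr 1; ring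
  have h3 : exp (l * t) / 2 ≤ cosh (l * t) := by
    rw [Real.cosh_eq]; have := exp_pos (-(l*t)); linarith
  have h4 : exp (l * t) / 2 * P.real {x | t ≤ ‖∑ i, f (x i)‖} ≤ exp (n * (l * R) ^ 2 / 2) := by
    refine (mul_le_mul h3 hsub measureReal_nonneg (cosh_pos _).le).trans (hM.trans (hp.trans ?_))
    simpa using h2
  rw [Real.exp_sub]
  have := exp_pos (l * t)
  rw [mul_div_assoc', le_div_iff₀ this]
  linarith
end Pinelis

lemma shell_closed (d n : ℕ) (ε : ℝ) : IsClosed (sphericalShell d n ε) := by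
  have h1 : IsClosed {v : EU d | (1 - ε) * ((d : ℝ) / n) ≤ ‖v‖ ^ 2} :=
    isClosed_le continuous_const (by fun_prop)
  have h2 : IsClosed {v : EU d | ‖v‖ ^ 2 ≤ (1 + ε) * ((d : ℝ) / n)} :=
    isClosed_le (by fun_prop) continuous_const
  exact h1.inter h2

lemma shell_norm_le {d n : ℕ} {ε : ℝ} {v : EU d} (hv : v ∈ sphericalShell d n ε) :
    ‖v‖ ≤ √((1 + ε) * ((d : ℝ) / n)) := Real.le_sqrt_of_sq_le hv.2

lemma shell_ne_zero {d n : ℕ} {ε : ℝ} (hd : 1 ≤ d) (hn : 1 ≤ n) (hε : ε < 1) {v : EU d}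
    (hv : v ∈ sphericalShell d n ε) : v ≠ 0 := by
  rintro rfl
  have h := hv.1
  have hd0 : (0:ℝ) < d := by exact_mod_cast hd
  have hn0 : (0:ℝ) < n := by exact_mod_cast hn
  have : 0 < (1 - ε) * ((d : ℝ) / n) := mul_pos (by linarith) (by positivity)
  simp only [norm_zero] at h
  norm_num at h
  linarith

def openShell (d n : ℕ) (ε : ℝ) : Set (EU d) :=
  {v | (1 - ε) * ((d : ℝ) / n) < ‖v‖ ^ 2 ∧ ‖v‖ ^ 2 < (1 + ε) * ((d : ℝ) / n)}

lemma openShell_open (d n : ℕ) (ε : ℝ) : IsOpen (openShell d n ε) := by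
  have h1 : IsOpen {v : EU d | (1 - ε) * ((d : ℝ) / n) < ‖v‖ ^ 2} :=
    isOpen_lt continuous_const (by fun_prop)
  have h2 : IsOpen {v : EU d | ‖v‖ ^ 2 < (1 + ε) * ((d : ℝ) / n)} :=
    isOpen_lt (by fun_prop) continuous_const
  exact h1.inter h2

lemma openShell_sub (d n : ℕ) (ε : ℝ) : openShell d n ε ⊆ sphericalShell d n ε :=
  fun _ hv => ⟨hv.1.le, hv.2.le⟩

lemma shell_vol_ne_top (d n : ℕ) (ε : ℝ) :
    (volume : Measure (EU d)) (sphericalShell d n ε) ≠ ⊤ := by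
  refine ne_of_lt (lt_of_le_of_lt (measure_mono (fun v hv => ?_))
    (measure_closedBall_lt_top (x := (0 : EU d)) (r := √((1 + ε) * ((d : ℝ) / n)))))
  rw [mem_closedBall_zero_iff]
  exact shell_norm_le hv

lemma mem_openShell {d n : ℕ} {ε : ℝ} (hd : 1 ≤ d) (hn : 1 ≤ n) (hε : 0 < ε) {v : EU d}
    (hv : ‖v‖ ^ 2 = (d : ℝ) / n) : v ∈ openShell d n ε := by
  have hd0 : (0:ℝ) < d := by exact_mod_cast hd
  have hn0 : (0:ℝ) < n := by exact_mod_cast hn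
  have : 0 < (d : ℝ) / n := by positivity
  constructor <;> rw [hv] <;> nlinarith

lemma shell_vol_ne_zero {d n : ℕ} {ε : ℝ} (hd : 1 ≤ d) (hn : 1 ≤ n) (hε : 0 < ε) :
    (volume : Measure (EU d)) (sphericalShell d n ε) ≠ 0 := by
  have h1 : (openShell d n ε).Nonempty := by
    refine ⟨EuclideanSpace.single ⟨0, hd⟩ (√((d:ℝ)/n)), mem_openShell hd hn hε ?_⟩
    rw [EuclideanSpace.norm_single, Real.norm_eq_abs, sq_abs, Real.sq_sqrt (by positivity)]
  have h2 := (openShell_open d n ε).measure_pos volume h1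
  exact (lt_of_lt_of_le h2 (measure_mono (openShell_sub d n ε))).ne'

lemma shell_prob {d n : ℕ} {ε : ℝ} (hd : 1 ≤ d) (hn : 1 ≤ n) (hε : 0 < ε) :
    IsProbabilityMeasure ((volume : Measure (EU d))[|sphericalShell d n ε]) :=
  cond_isProbabilityMeasure_of_finite (shell_vol_ne_zero hd hn hε) (shell_vol_ne_top d n ε)

lemma shell_ae (d n : ℕ) (ε : ℝ) :
    ∀ᵐ x ∂((volume : Measure (EU d))[|sphericalShell d n ε]), x ∈ sphericalShell d n ε :=
  ae_cond_mem (shell_closed d n ε).measurableSet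

def RotInv {d : ℕ} (μ : Measure (EU d)) : Prop :=
  ∀ L : EU d ≃ₗᵢ[ℝ] EU d, MeasurePreserving L μ μ

lemma shell_rot (d n : ℕ) (ε : ℝ) :
    RotInv ((volume : Measure (EU d))[|sphericalShell d n ε]) := by
  intro L
  have h1 := (L.measurePreserving).restrict_preimage (shell_closed d n ε).measurableSet
  have h2 : L ⁻¹' (sphericalShell d n ε) = sphericalShell d n ε := by
    ext v; simp [sphericalShell]
  rw [h2] at h1
  exact h1.smul_measure _

section Rot
variable {d : ℕ} {μ : Measure (EU d)}

lemma int_cont [IsFiniteMeasure μ] {M : ℝ} (hM : ∀ᵐ x ∂μ, ‖x‖ ≤ M) (f : EU d → ℝ)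
    (hf : Continuous f) : Integrable f μ := by
  obtain ⟨C, hC⟩ := (isCompact_closedBall (0 : EU d) M).exists_bound_of_continuousOn hf.continuousOn
  refine Integrable.of_bound hf.aestronglyMeasurable C ?_
  filter_upwards [hM] with x hx
  exact hC x (mem_closedBall_zero_iff.2 hx)

lemma rot_eq (hμ : RotInv μ) (g : ℝ → ℝ → ℝ) (v w : EU d) (h : ‖v‖ = ‖w‖) :
    ∫ x, g (inner ℝ v x) ‖x‖ ∂μ = ∫ x, g (inner ℝ w x) ‖x‖ ∂μ := by
  set L := (ℝ ∙ (v - w))ᗮ.reflection with hL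
  have hLv : L v = w := Submodule.reflection_sub h
  rw [← (hμ L).integral_comp (L.toHomeomorph.measurableEmbedding) (fun x => g (inner ℝ w x) ‖x‖)]
  rw [← hLv]
  simp only [L.inner_map_map, L.norm_map]

lemma sum_coord_sq (x : EU d) : ∑ a, inner ℝ (EuclideanSpace.basisFun (Fin d) ℝ a) x ^ 2 = ‖x‖ ^ 2 := by
  rw [← (EuclideanSpace.basisFun (Fin d) ℝ).sum_sq_norm_inner_right x]
  simp

lemma mom2_int (φ : ℝ → ℝ) (hφ : Measurable φ)
    (hI : Integrable (fun x : EU d => φ ‖x‖ * ‖x‖ ^ 2) μ) (v w : EU d) :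
    Integrable (fun x : EU d => φ ‖x‖ * (inner ℝ v x * inner ℝ w x)) μ := by
  refine (hI.mul_const (‖v‖ * ‖w‖)).mono (Measurable.aestronglyMeasurable ?_) (Filter.Eventually.of_forall (fun x => ?_))
  · exact (hφ.comp measurable_norm).mul ((by fun_prop : Continuous fun x : EU d => inner ℝ v x * inner ℝ w x).measurable)
  · rw [norm_mul, norm_mul, norm_mul, norm_mul (φ _)]
    have h1 := norm_inner_le_norm (𝕜 := ℝ) v x
    have h2 := norm_inner_le_norm (𝕜 := ℝ) w x
    have h3 : ‖inner ℝ v x‖ * ‖inner ℝ w x‖ ≤ (‖v‖ * ‖x‖) * (‖w‖ * ‖x‖) :=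
      mul_le_mul h1 h2 (norm_nonneg _) (by positivity)
    have h4 := mul_le_mul_of_nonneg_left h3 (norm_nonneg (φ ‖x‖))
    rw [Real.norm_of_nonneg (by positivity : 0 ≤ ‖x‖ ^ 2), Real.norm_of_nonneg (by positivity : 0 ≤ ‖v‖ * ‖w‖)]
    linarith

lemma mom2 (hd : 1 ≤ d) (hμ : RotInv μ) (φ : ℝ → ℝ) (hφ : Measurable φ)
    (hI : Integrable (fun x : EU d => φ ‖x‖ * ‖x‖ ^ 2) μ) (v : EU d) :
    ∫ x, φ ‖x‖ * inner ℝ v x ^ 2 ∂μ = ‖v‖ ^ 2 / d * ∫ x, φ ‖x‖ * ‖x‖ ^ 2 ∂μ := by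
  set e := EuclideanSpace.basisFun (Fin d) ℝ
  have h1 : ∀ a, ∫ x, φ ‖x‖ * inner ℝ v x ^ 2 ∂μ = ‖v‖ ^ 2 * ∫ x, φ ‖x‖ * inner ℝ (e a) x ^ 2 ∂μ := by
    intro a
    rw [rot_eq hμ (fun s r => φ r * s ^ 2) v (‖v‖ • e a) (by rw [norm_smul, e.norm_eq_one]; simp),
      ← integral_const_mul]
    refine integral_congr_ae (Filter.Eventually.of_forall (fun x => ?_))
    simp only [inner_smul_left, conj_trivial]; ring
  have h2 : ∑ a : Fin d, ∫ x, φ ‖x‖ * inner ℝ v x ^ 2 ∂μ = ‖v‖ ^ 2 * ∫ x, φ ‖x‖ * ‖x‖ ^ 2 ∂μ := by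
    rw [Finset.sum_congr rfl (fun a _ => h1 a), ← Finset.mul_sum, ← integral_finsetSum]
    · congr 1
      refine integral_congr_ae (Filter.Eventually.of_forall (fun x => ?_))
      simp only
      rw [← Finset.mul_sum, sum_coord_sq]
    · intro a _
      simpa [sq] using mom2_int φ hφ hI (e a) (e a)
  simp only [Finset.sum_const, Finset.card_univ, Fintype.card_fin, nsmul_eq_mul] at h2
  have hd0 : (0:ℝ) < d := by exact_mod_cast hd
  field_simp
  linarith

lemma mom2_bil (hd : 1 ≤ d) (hμ : RotInv μ) (φ : ℝ → ℝ) (hφ : Measurable φ)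
    (hI : Integrable (fun x : EU d => φ ‖x‖ * ‖x‖ ^ 2) μ) (v w : EU d) :
    ∫ x, φ ‖x‖ * (inner ℝ v x * inner ℝ w x) ∂μ = inner ℝ v w / d * ∫ x, φ ‖x‖ * ‖x‖ ^ 2 ∂μ := by
  have h1 := mom2 hd hμ φ hφ hI (v + w)
  have h2 := mom2 hd hμ φ hφ hI v
  have h3 := mom2 hd hμ φ hφ hI w
  have i1 := mom2_int φ hφ hI v v
  have i2 := mom2_int φ hφ hI w w
  have i3 := mom2_int φ hφ hI v w
  have e : ∫ x, φ ‖x‖ * inner ℝ (v + w) x ^ 2 ∂μ = ∫ x, φ ‖x‖ * inner ℝ v x ^ 2 ∂μ +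
      ∫ x, φ ‖x‖ * inner ℝ w x ^ 2 ∂μ + 2 * ∫ x, φ ‖x‖ * (inner ℝ v x * inner ℝ w x) ∂μ := by
    simp only [sq]
    rw [← integral_const_mul, ← integral_add i1 i2, ← integral_add (i1.fun_add i2) (i3.const_mul 2)]
    refine integral_congr_ae (Filter.Eventually.of_forall (fun x => ?_))
    simp only [inner_add_left]; ring
  rw [h1, h2, h3, norm_add_sq_real] at e
  have hd0 : (0:ℝ) < d := by exact_mod_cast hd
  field_simp at e ⊢
  linarith

lemma mom4 [IsFiniteMeasure μ] {M : ℝ} (hM : ∀ᵐ x ∂μ, ‖x‖ ≤ M) (hd : 1 ≤ d) (hμ : RotInv μ)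
    (v : EU d) (hv : ‖v‖ = 1) :
    ∫ x, inner ℝ v x ^ 4 ∂μ = 3 / (d * (d + 2)) * ∫ x, ‖x‖ ^ 4 ∂μ := by
  set e := EuclideanSpace.basisFun (Fin d) ℝ
  set m4 := ∫ x, inner ℝ v x ^ 4 ∂μ with hm4
  have hE : ∀ u : EU d, ‖u‖ ^ 2 = 2 → ∫ x, inner ℝ u x ^ 4 ∂μ = 4 * m4 := by
    intro u hu
    rw [rot_eq hμ (fun s r => s ^ 4) u (‖u‖ • v) (by rw [norm_smul, hv]; simp), hm4,
      ← integral_const_mul]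
    refine integral_congr_ae (Filter.Eventually.of_forall (fun x => ?_))
    simp only [inner_smul_left, conj_trivial]
    rw [mul_pow, show ‖u‖ ^ 4 = (‖u‖ ^ 2) ^ 2 by ring, hu]; ring
  have hsame : ∀ a, ∫ x, inner ℝ (e a) x ^ 4 ∂μ = m4 := by
    intro a
    exact rot_eq hμ (fun s r => s ^ 4) (e a) v (by rw [hv, e.norm_eq_one])
  let a0 : Fin d := ⟨0, hd⟩
  have hab : ∀ b, b ≠ a0 → ∫ x, inner ℝ (e a0) x ^ 2 * inner ℝ (e b) x ^ 2 ∂μ = m4 / 3 := by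
    intro b hb
    have ho : inner ℝ (e a0) (e b) = 0 := e.orthonormal.2 hb.symm
    have h1 := hE (e a0 + e b) (by rw [norm_add_sq_real, ho, e.norm_eq_one, e.norm_eq_one]; norm_num)
    have h2 := hE (e a0 - e b) (by rw [norm_sub_sq_real, ho, e.norm_eq_one, e.norm_eq_one]; norm_num)
    have h3 : ∫ x, inner ℝ (e a0 + e b) x ^ 4 ∂μ + ∫ x, inner ℝ (e a0 - e b) x ^ 4 ∂μ =
        2 * ∫ x, inner ℝ (e a0) x ^ 4 ∂μ + 2 * ∫ x, inner ℝ (e b) x ^ 4 ∂μ +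
        12 * ∫ x, inner ℝ (e a0) x ^ 2 * inner ℝ (e b) x ^ 2 ∂μ := by
      have j1 := int_cont (μ := μ) hM (fun x => inner ℝ (e a0 + e b) x ^ 4) (by fun_prop)
      have j2 := int_cont (μ := μ) hM (fun x => inner ℝ (e a0 - e b) x ^ 4) (by fun_prop)
      have j3 := int_cont (μ := μ) hM (fun x => inner ℝ (e a0) x ^ 4) (by fun_prop)
      have j4 := int_cont (μ := μ) hM (fun x => inner ℝ (e b) x ^ 4) (by fun_prop)
      have j5 := int_cont (μ := μ) hM (fun x => inner ℝ (e a0) x ^ 2 * inner ℝ (e b) x ^ 2) (by fun_prop)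
      rw [← integral_add j1 j2, ← integral_const_mul, ← integral_const_mul, ← integral_const_mul,
        ← integral_add (j3.const_mul 2) (j4.const_mul 2),
        ← integral_add ((j3.const_mul 2).fun_add (j4.const_mul 2)) (j5.const_mul 12)]
      refine integral_congr_ae (Filter.Eventually.of_forall (fun x => ?_))
      simp only [inner_add_left, inner_sub_left]; ring
    rw [h1, h2, hsame, hsame] at h3
    linarith
  have hsum : ∫ x, ‖x‖ ^ 2 * inner ℝ (e a0) x ^ 2 ∂μ = (d + 2) / 3 * m4 := by
    have h1 : ∫ x, ‖x‖ ^ 2 * inner ℝ (e a0) x ^ 2 ∂μ =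
        ∑ b, ∫ x, inner ℝ (e a0) x ^ 2 * inner ℝ (e b) x ^ 2 ∂μ := by
      rw [← integral_finsetSum]
      · refine integral_congr_ae (Filter.Eventually.of_forall (fun x => ?_))
        simp only
        rw [← Finset.mul_sum, sum_coord_sq]; ring
      · intro b _
        exact int_cont hM _ (by fun_prop)
    rw [h1, ← Finset.add_sum_erase _ _ (Finset.mem_univ a0),
      Finset.sum_congr rfl (fun b hb => hab b (Finset.ne_of_mem_erase hb))]
    have h2 : ∫ x, inner ℝ (e a0) x ^ 2 * inner ℝ (e a0) x ^ 2 ∂μ = m4 := by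
      rw [← hsame a0]
      refine integral_congr_ae (Filter.Eventually.of_forall (fun x => ?_))
      simp only; ring
    rw [h2, Finset.sum_const, Finset.card_erase_of_mem (Finset.mem_univ _)]
    simp only [Finset.card_univ, Fintype.card_fin, nsmul_eq_mul]
    rw [Nat.cast_sub hd]; push_cast; ring
  have h5 := mom2 hd hμ (fun r => r ^ 2) (by fun_prop) (int_cont hM _ (by fun_prop)) (e a0)
  rw [hsum, e.norm_eq_one] at h5
  have h6 : ∫ x : EU d, ‖x‖ ^ 2 * ‖x‖ ^ 2 ∂μ = ∫ x, ‖x‖ ^ 4 ∂μ :=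
    integral_congr_ae (Filter.Eventually.of_forall (fun x => by simp only; ring))
  rw [h6] at h5
  have hd0 : (0:ℝ) < d := by exact_mod_cast hd
  field_simp at h5 ⊢
  linarith
end Rot

lemma XV_measurable (d n : ℕ) : Measurable (XV d n) := by
  have h1 : Continuous (QQ : EU d → VV d) := by
    unfold QQ
    fun_prop
  unfold XV
  refine Measurable.sub (Measurable.fun_smul ?_ h1.measurable) measurable_const
  fun_prop

lemma XV_norm_le {d n : ℕ} (hd : 2 ≤ d) (x : EU d) :
    ‖XV d n x‖ ≤ √((d : ℝ) * (d - 1)) / (n : ℝ) := by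
  by_cases hx : x = 0
  · subst hx
    have h2 : (2:ℝ) ≤ d := by exact_mod_cast hd
    have h1 : XV d n 0 = - ((1 / (n : ℝ)) • IV d) := by
      simp [XV]
    have h3 : ‖IV d‖ = √d := by
      rw [← Real.sqrt_sq (norm_nonneg (IV d)), ← real_inner_self_eq_norm_sq, IV_self]
    rw [h1, norm_neg, norm_smul, h3, Real.norm_of_nonneg (by positivity)]
    rw [one_div, inv_mul_eq_div]
    gcongr
    nlinarith
  · exact (XV_norm x hx).le

lemma XV_mean {d n : ℕ} {ε : ℝ} (hd : 1 ≤ d) (hn : 1 ≤ n) (hε : 0 < ε) (hε1 : ε < 1) (A : VV d) :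
    ∫ x, inner ℝ A (XV d n x) ∂((volume : Measure (EU d))[|sphericalShell d n ε]) = 0 := by
  set μ := (volume : Measure (EU d))[|sphericalShell d n ε] with hμ
  have : IsProbabilityMeasure μ := shell_prob hd hn hε
  have hd0 : (0:ℝ) < d := by exact_mod_cast hd
  have hn0 : (0:ℝ) < n := by exact_mod_cast hn
  set φ : ℝ → ℝ := fun r => 1 / r ^ 2 with hφd
  have hφ : Measurable φ := by fun_prop
  have hone : (fun x : EU d => φ ‖x‖ * ‖x‖ ^ 2) =ᵐ[μ] fun _ => (1:ℝ) := by
    filter_upwards [shell_ae d n ε] with x hx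
    have : ‖x‖ ≠ 0 := norm_ne_zero_iff.2 (shell_ne_zero hd hn hε1 hx)
    simp only [hφd]
    field_simp
  have hI : Integrable (fun x : EU d => φ ‖x‖ * ‖x‖ ^ 2) μ := (integrable_const 1).congr hone.symm
  set e := EuclideanSpace.basisFun (Fin d) ℝ
  have hb : ∀ a b, ∫ x, φ ‖x‖ * (inner ℝ (e a) x * inner ℝ (e b) x) ∂μ = (if a = b then 1 else 0) / d := by
    intro a b
    rw [mom2_bil hd (shell_rot d n ε) φ hφ hI, integral_congr_ae hone,
      orthonormal_iff_ite.1 e.orthonormal]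
    simp
  have hrep : ∀ x, inner ℝ A (XV d n x) = ∑ a, ∑ b, A (a, b) *
      ((d : ℝ) / n * (φ ‖x‖ * (inner ℝ (e a) x * inner ℝ (e b) x)) - 1 / n * (if a = b then 1 else 0)) := by
    intro x
    rw [vv_inner]
    refine Finset.sum_congr rfl (fun a _ => Finset.sum_congr rfl (fun b _ => ?_))
    have he : ∀ a, inner ℝ (e a) x = x a := fun a => by
      rw [← e.repr_apply_apply]; simp [e]
    rw [he, he]
    simp [XV, QQ, IV, hφd]
    left; ring
  have hInt0 : ∀ a b, Integrable (fun x => A (a, b) *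
      ((d : ℝ) / n * (φ ‖x‖ * (inner ℝ (e a) x * inner ℝ (e b) x)) - 1 / n * (if a = b then 1 else 0))) μ :=
    fun a b => ((((mom2_int φ hφ hI (e a) (e b)).const_mul _).sub (integrable_const _)).const_mul _)
  simp only [hrep]
  rw [integral_finsetSum _ (fun a _ => integrable_finsetSum _ (fun b _ => hInt0 a b))]
  refine Finset.sum_eq_zero (fun a _ => ?_)
  rw [integral_finsetSum _ (fun b _ => hInt0 a b)]
  refine Finset.sum_eq_zero (fun b _ => ?_)
  rw [integral_const_mul, integral_sub ((mom2_int φ hφ hI (e a) (e b)).const_mul _) (integrable_const _),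
    integral_const_mul, hb]
  simp only [integral_const, probReal_univ, smul_eq_mul, one_mul]
  field_simp
  simp

lemma frob_tail {d n : ℕ} {ε : ℝ} (hd : 2 ≤ d) (hn : 1 ≤ n) (hε : 0 < ε) (hε1 : ε < 1)
    (t : ℝ) (ht : 0 < t) :
    (Measure.pi fun _ : Fin n => (volume : Measure (EU d))[|sphericalShell d n ε]).real
      {x | t ≤ ‖∑ i, XV d n (x i)‖} ≤ 2 * exp (-(n * t ^ 2 / (2 * d ^ 2))) := by
  have := shell_prob (d := d) (n := n) (by omega) hn hε
  have hd0 : (2:ℝ) ≤ d := by exact_mod_cast hd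
  have hn0 : (0:ℝ) < n := by exact_mod_cast hn
  have h := pinelis_tail ((volume : Measure (EU d))[|sphericalShell d n ε]) (XV d n)
    (XV_measurable d n) _ (XV_norm_le hd) (by
      filter_upwards [shell_ae d n ε] with x hx
      exact XV_norm x (shell_ne_zero (by omega) hn hε1 hx)) (XV_mean (by omega) hn hε hε1) n
      (t * n / d ^ 2) t (by positivity) ht.le
  refine h.trans ?_
  gcongr
  rw [mul_pow, div_pow _ (n:ℝ), Real.sq_sqrt (by nlinarith)]
  have e : (n:ℝ) * ((t * n / d ^ 2) ^ 2 * (d * (d - 1) / n ^ 2)) / 2 - t * n / d ^ 2 * t =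
     -(n * t ^ 2 / (2 * d ^ 2)) - n * t ^ 2 / (2 * d ^ 3) := by
    field_simp
    ring
  rw [e]
  have : 0 ≤ n * t ^ 2 / (2 * d ^ 3) := by positivity
  linarith

lemma poly_ineq (k : ℕ) (a b : ℝ) (ha : 0 ≤ a) (hb : 0 ≤ b) :
    (k + 2) * a ^ 2 * b ^ k ≤ 2 * a ^ (k + 2) + k * b ^ (k + 2) := by
  induction k with
  | zero => simp
  | succ k ih =>
    have h1 := mul_le_mul_of_nonneg_left ih hb
    have h2 : 0 ≤ (a - b) * (a * (a ^ (k+1) - b ^ (k+1)) + (a ^ (k+2) - b ^ (k+2))) := by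
      rcases le_total a b with h | h
      · have i1 := pow_le_pow_left₀ ha h (k+1)
        have i2 := pow_le_pow_left₀ ha h (k+2)
        refine mul_nonneg_of_nonpos_of_nonpos (by linarith) ?_
        nlinarith
      · have i1 := pow_le_pow_left₀ hb h (k+1)
        have i2 := pow_le_pow_left₀ hb h (k+2)
        refine mul_nonneg (by linarith) ?_
        nlinarith
    push_cast
    ring_nf at h1 h2 ⊢
    linarith

lemma radial_int (d : ℕ) (hd : 1 ≤ d) (r0 r1 β : ℝ) (h0 : 0 < r0) (h01 : r0 ≤ r1) :
    ∫ x : EU d, (Set.Icc r0 r1).indicator (fun r => r ^ 2 - β) ‖x‖ =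
      d * (volume : Measure (EU d)).real (Metric.ball 0 1) *
        ((r1 ^ (d + 2) - r0 ^ (d + 2)) / (d + 2) - β * ((r1 ^ d - r0 ^ d) / d)) := by
  have : Nontrivial (EU d) := by
    have : Nonempty (Fin d) := ⟨⟨0, hd⟩⟩
    infer_instance
  rw [integral_fun_norm_addHaar]
  simp only [finrank_euclideanSpace, Fintype.card_fin, nsmul_eq_mul, smul_eq_mul]
  rw [mul_assoc]
  congr 2
  have h1 : ∀ y : ℝ, y ^ (d - 1) * (Set.Icc r0 r1).indicator (fun r => r ^ 2 - β) y =
      (Set.Icc r0 r1).indicator (fun r => r ^ (d - 1) * (r ^ 2 - β)) y := by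
    intro y
    by_cases hy : y ∈ Set.Icc r0 r1 <;> simp [hy]
  simp only [h1]
  rw [setIntegral_indicator measurableSet_Icc, Set.inter_eq_right.2 (show Set.Icc r0 r1 ⊆ Set.Ioi 0 from fun y hy => lt_of_lt_of_le h0 hy.1),
    integral_Icc_eq_integral_Ioc, ← intervalIntegral.integral_of_le h01]
  have h2 : ∀ y : ℝ, y ^ (d - 1) * (y ^ 2 - β) = y ^ (d + 1) - β * y ^ (d - 1) := by
    intro y
    obtain ⟨k, rfl⟩ : ∃ k, d = k + 1 := ⟨d - 1, by omega⟩
    simp only [Nat.add_sub_cancel]; ring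
  simp only [h2]
  rw [intervalIntegral.integral_sub (Continuous.intervalIntegrable (by fun_prop) _ _) (Continuous.intervalIntegrable (by fun_prop) _ _), intervalIntegral.integral_const_mul,
    integral_pow, integral_pow]
  obtain ⟨k, rfl⟩ : ∃ k, d = k + 1 := ⟨d - 1, by omega⟩
  simp only [Nat.add_sub_cancel]
  push_cast
  ring_nf

lemma shell_int_radial {d n : ℕ} {ε : ℝ} (hd : 1 ≤ d) (hn : 1 ≤ n) (hε : 0 < ε) (hε1 : ε < 1) (β : ℝ) :
    ∃ C : ℝ, 0 ≤ C ∧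
      ∫ x, ‖x‖ ^ 2 ∂((volume : Measure (EU d))[|sphericalShell d n ε]) - β =
      C * ((d * (√((1+ε)*((d:ℝ)/n)) ^ (d + 2) - √((1-ε)*((d:ℝ)/n)) ^ (d + 2))) -
        (d + 2) * β * (√((1+ε)*((d:ℝ)/n)) ^ d - √((1-ε)*((d:ℝ)/n)) ^ d)) := by
  have hp := shell_prob (d := d) (n := n) hd hn hε
  have hd0 : (0:ℝ) < d := by exact_mod_cast hd
  have hn0 : (0:ℝ) < n := by exact_mod_cast hn
  set r0 := √((1-ε)*((d:ℝ)/n)) with hr0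
  set r1 := √((1+ε)*((d:ℝ)/n)) with hr1
  have hc : 0 < (d:ℝ)/n := by positivity
  have h0 : 0 < r0 := Real.sqrt_pos.2 (mul_pos (by linarith) hc)
  have h01 : r0 ≤ r1 := Real.sqrt_le_sqrt (by nlinarith)
  have hshell : ∀ x : EU d, x ∈ sphericalShell d n ε ↔ ‖x‖ ∈ Set.Icc r0 r1 := by
    intro x
    simp only [sphericalShell, Set.mem_Icc, Set.mem_ofPred_eq, hr0, hr1]
    rw [Real.sqrt_le_left (norm_nonneg _), Real.le_sqrt (norm_nonneg _)]
    exact mul_nonneg (by linarith) hc.le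
  have hi : Integrable (fun x : EU d => ‖x‖ ^ 2) ((volume : Measure (EU d))[|sphericalShell d n ε]) :=
    int_cont (M := r1) (by filter_upwards [shell_ae d n ε] with x hx; exact ((hshell x).1 hx).2) _ (by fun_prop)
  refine ⟨((volume : Measure (EU d)).real (sphericalShell d n ε))⁻¹ * ((volume : Measure (EU d)).real (Metric.ball 0 1)) / (d + 2), by positivity, ?_⟩
  have h1 : ∫ x, ‖x‖ ^ 2 ∂((volume : Measure (EU d))[|sphericalShell d n ε]) - β =
      ∫ x, (‖x‖ ^ 2 - β) ∂((volume : Measure (EU d))[|sphericalShell d n ε]) := by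
    rw [integral_sub hi (integrable_const _)]; simp
  rw [h1, ProbabilityTheory.cond, integral_smul_measure]
  have h2 : ∫ x in sphericalShell d n ε, (‖x‖ ^ 2 - β) = ∫ x : EU d, (Set.Icc r0 r1).indicator (fun r => r ^ 2 - β) ‖x‖ := by
    rw [← integral_indicator (shell_closed d n ε).measurableSet]
    refine integral_congr_ae (Filter.Eventually.of_forall (fun x => ?_))
    by_cases hx : x ∈ sphericalShell d n ε
    · simp only [Set.indicator_of_mem hx, Set.indicator_of_mem ((hshell x).1 hx)]
    · simp only [Set.indicator_of_notMem hx, Set.indicator_of_notMem (fun h => hx ((hshell x).2 h))]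
  rw [h2, radial_int d hd r0 r1 β h0 h01, smul_eq_mul, ENNReal.toReal_inv]
  simp only [Measure.real]
  field_simp

lemma shell_mean {d n : ℕ} {ε : ℝ} (hd : 2 ≤ d) (hn : 1 ≤ n) (hε : 0 < ε) (hε1 : ε < 1) :
    |∫ x, ‖x‖ ^ 2 ∂((volume : Measure (EU d))[|sphericalShell d n ε]) - (d:ℝ)/n| ≤
      (ε - 4 * ε / (d + 2)) * ((d:ℝ)/n) := by
  have hd0 : (0:ℝ) < d := by exact_mod_cast (by omega : 0 < d)
  have hn0 : (0:ℝ) < n := by exact_mod_cast hn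
  have hc : 0 < (d:ℝ)/n := by positivity
  obtain ⟨k, rfl⟩ : ∃ k, d = k + 2 := ⟨d - 2, by omega⟩
  set D : ℕ := k + 2 with hD
  have hDk : (D:ℝ) = k + 2 := by rw [hD]; push_cast; ring
  set c := (D:ℝ)/n
  obtain ⟨C1, hC1, e1⟩ := shell_int_radial (d := D) (n := n) (ε := ε) (by omega) hn hε hε1
    ((D * ((1+ε)*c) + 2 * ((1-ε)*c)) / (D + 2))
  obtain ⟨C2, hC2, e2⟩ := shell_int_radial (d := D) (n := n) (ε := ε) (by omega) hn hε hε1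
    ((D * ((1-ε)*c) + 2 * ((1+ε)*c)) / (D + 2))
  set r0 := √((1-ε)*c) with hr0
  set r1 := √((1+ε)*c) with hr1
  have h0 : 0 ≤ r0 := Real.sqrt_nonneg _
  have h1 : 0 ≤ r1 := Real.sqrt_nonneg _
  have hs0 : (1-ε)*c = r0 ^ 2 := (Real.sq_sqrt (by nlinarith)).symm
  have hs1 : (1+ε)*c = r1 ^ 2 := (Real.sq_sqrt (by nlinarith)).symm
  have p1 := poly_ineq k r1 r0 h1 h0
  have p2 := poly_ineq k r0 r1 h0 h1
  rw [abs_le]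
  set m := ∫ x, ‖x‖ ^ 2 ∂((volume : Measure (EU D))[|sphericalShell D n ε])
  have hu : m ≤ (D * ((1+ε)*c) + 2 * ((1-ε)*c)) / (D + 2) := by
    suffices m - (D * ((1+ε)*c) + 2 * ((1-ε)*c)) / (D + 2) ≤ 0 by linarith
    rw [e1]
    refine mul_nonpos_of_nonneg_of_nonpos hC1 ?_
    rw [mul_div_cancel₀ _ (by positivity), hs0, hs1, hDk]
    have p1' := mul_le_mul_of_nonneg_left p1 (pow_nonneg h0 2)
    rw [hD]
    ring_nf at p1' ⊢
    linarith
  have hl : (D * ((1-ε)*c) + 2 * ((1+ε)*c)) / (D + 2) ≤ m := by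
    suffices 0 ≤ m - (D * ((1-ε)*c) + 2 * ((1+ε)*c)) / (D + 2) by linarith
    rw [e2]
    refine mul_nonneg hC2 ?_
    rw [mul_div_cancel₀ _ (by positivity), hs0, hs1, hDk]
    have p2' := mul_le_mul_of_nonneg_left p2 (pow_nonneg h1 2)
    rw [hD]
    ring_nf at p2' ⊢
    linarith
  have q1 : (D * ((1+ε)*c) + 2 * ((1-ε)*c)) / (D + 2) = c + (ε - 4 * ε / (D + 2)) * c := by
    field_simp; ring
  have q2 : (D * ((1-ε)*c) + 2 * ((1+ε)*c)) / (D + 2) = c - (ε - 4 * ε / (D + 2)) * c := by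
    field_simp; ring
  constructor <;> linarith

lemma card_sep {d : ℕ} (s : Finset (EU d)) (hs : ∀ c ∈ s, ‖c‖ = 1)
    (h : ∀ c ∈ s, ∀ e ∈ s, c ≠ e → 1 / 4 ≤ ‖c - e‖) : s.card ≤ 9 ^ d := by
  let μ : Measure (EU d) := volume
  let δ : ℝ := (1 : ℝ) / 8
  let ρ : ℝ := (9 : ℝ) / 8
  have ρpos : 0 < ρ := by norm_num [ρ]
  set A := ⋃ c ∈ s, Metric.ball (c : EU d) δ with hA
  have D : Set.Pairwise (s : Set (EU d)) (Function.onFun Disjoint fun c => Metric.ball (c : EU d) δ) := by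
    rintro c hc e he hce
    apply Metric.ball_disjoint_ball
    rw [dist_eq_norm]
    refine le_trans ?_ (h c hc e he hce)
    norm_num [δ]
  have A_subset : A ⊆ Metric.ball (0 : EU d) ρ := by
    refine Set.iUnion₂_subset fun x hx => ?_
    apply Metric.ball_subset_ball'
    rw [dist_zero_right, hs x hx]
    norm_num [δ, ρ]
  have I :
    (s.card : ENNReal) * ENNReal.ofReal (δ ^ d) * μ (Metric.ball 0 1) ≤
      ENNReal.ofReal (ρ ^ d) * μ (Metric.ball 0 1) :=
    calc
      (s.card : ENNReal) * ENNReal.ofReal (δ ^ d) * μ (Metric.ball 0 1) = μ A := by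
        rw [hA, measure_biUnion_finset D fun c _ => measurableSet_ball]
        have I : 0 < δ := by norm_num [δ]
        simp only [μ.addHaar_ball_of_pos _ I]
        simp only [Finset.sum_const, nsmul_eq_mul, mul_assoc, finrank_euclideanSpace, Fintype.card_fin]
      _ ≤ μ (Metric.ball (0 : EU d) ρ) := measure_mono A_subset
      _ = ENNReal.ofReal (ρ ^ d) * μ (Metric.ball 0 1) := by
        simp only [μ.addHaar_ball_of_pos _ ρpos, finrank_euclideanSpace, Fintype.card_fin]
  have J : (s.card : ENNReal) * ENNReal.ofReal (δ ^ d) ≤ ENNReal.ofReal (ρ ^ d) :=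
    (ENNReal.mul_le_mul_iff_left (Metric.measure_ball_pos _ _ zero_lt_one).ne' measure_ball_lt_top.ne).1 I
  have K : (s.card : ℝ) ≤ (9 : ℝ) ^ d := by
    have := ENNReal.toReal_le_of_le_ofReal (pow_nonneg ρpos.le _) J
    rw [ENNReal.toReal_mul, ENNReal.toReal_natCast, ENNReal.toReal_ofReal (by positivity)] at this
    simp only [δ, ρ, div_pow, one_pow] at this
    have h8 : (0:ℝ) < 8 ^ d := by positivity
    rw [mul_one_div, div_le_div_iff_of_pos_right h8] at this
    exact this
  exact_mod_cast K

lemma exists_net (d : ℕ) : ∃ N : Finset (EU d), (∀ c ∈ N, ‖c‖ = 1) ∧ N.card ≤ 9 ^ d ∧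
    ∀ v : EU d, ‖v‖ = 1 → ∃ u ∈ N, ‖v - u‖ ≤ 1 / 4 := by
  classical
  let C : Set ℕ := {k | ∃ s : Finset (EU d), (∀ c ∈ s, ‖c‖ = 1) ∧
    (∀ c ∈ s, ∀ e ∈ s, c ≠ e → 1 / 4 ≤ ‖c - e‖) ∧ s.card = k}
  have hC : C.Nonempty := ⟨0, ∅, by simp⟩
  have hB : BddAbove C := ⟨9 ^ d, by rintro k ⟨s, h1, h2, rfl⟩; exact card_sep s h1 h2⟩
  obtain ⟨N, h1, h2, h3⟩ := Nat.sSup_mem hC hB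
  refine ⟨N, h1, card_sep N h1 h2, fun v hv => ?_⟩
  by_contra hcon
  push Not at hcon
  have hvN : v ∉ N := fun h => by
    have := hcon v h
    simp at this
    linarith
  have hmem : (insert v N).card ∈ C := by
    refine ⟨insert v N, ?_, ?_, rfl⟩
    · intro c hc
      rcases Finset.mem_insert.1 hc with rfl | hc
      · exact hv
      · exact h1 c hc
    · intro c hc e he hce
      rcases Finset.mem_insert.1 hc with hc' | hc' <;> rcases Finset.mem_insert.1 he with he' | he'
      · exact absurd (hc'.trans he'.symm) hce
      · rw [hc']; exact (hcon e he').le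
      · rw [he', norm_sub_rev]; exact (hcon c hc').le
      · exact h2 c hc' e he' hce
  have := le_csSup hB hmem
  rw [Finset.card_insert_of_notMem hvN] at this
  omega

lemma quad_norm {d : ℕ} (T : EU d →L[ℝ] EU d) (hT : (T : EU d →ₗ[ℝ] EU d).IsSymmetric) (K : ℝ)
    (hK0 : 0 ≤ K) (h : ∀ v, ‖v‖ = 1 → |inner ℝ (T v) v| ≤ K) : ‖T‖ ≤ K := by
  rw [ContinuousLinearMap.norm_eq_iSup_rayleighQuotient T hT]
  refine ciSup_le (fun x => ?_)
  by_cases hx : x = 0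
  · subst hx; simpa using hK0
  · have hn : 0 < ‖x‖ := norm_pos_iff.2 hx
    have h1 := h (‖x‖⁻¹ • x) (by rw [norm_smul, norm_inv, norm_norm, inv_mul_cancel₀ hn.ne'])
    rw [map_smul, inner_smul_left, inner_smul_right] at h1
    refine le_trans (le_of_eq ?_) h1
    rw [ContinuousLinearMap.rayleighQuotient, ContinuousLinearMap.reApplyInnerSelf_apply]
    congr 1
    simp only [conj_trivial, RCLike.re_to_real]
    field_simp

lemma net_norm {d : ℕ} (N : Finset (EU d)) (hN1 : ∀ c ∈ N, ‖c‖ = 1)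
    (hN : ∀ v : EU d, ‖v‖ = 1 → ∃ u ∈ N, ‖v - u‖ ≤ 1 / 4)
    (T : EU d →L[ℝ] EU d) (hT : (T : EU d →ₗ[ℝ] EU d).IsSymmetric) (K : ℝ)
    (hK0 : 0 ≤ K) (h : ∀ v ∈ N, |inner ℝ (T v) v| ≤ K) : ‖T‖ ≤ 2 * K := by
  have h1 : ‖T‖ ≤ K + ‖T‖ / 2 := by
    refine quad_norm T hT _ (by positivity) (fun v hv => ?_)
    obtain ⟨u, hu, huv⟩ := hN v hv
    have e : inner ℝ (T v) v = inner ℝ (T u) u + (inner ℝ (T (v - u)) v + inner ℝ (T u) (v - u)) := by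
      rw [map_sub, inner_sub_left, inner_sub_right]; ring
    have b1 : |inner ℝ (T (v - u)) v| ≤ ‖T‖ / 4 := by
      refine (abs_real_inner_le_norm _ _).trans ?_
      rw [hv, mul_one]
      refine (T.le_opNorm _).trans ?_
      nlinarith [norm_nonneg T]
    have b2 : |inner ℝ (T u) (v - u)| ≤ ‖T‖ / 4 := by
      refine (abs_real_inner_le_norm _ _).trans ?_
      have := T.le_opNorm u
      rw [hN1 u hu, mul_one] at this
      nlinarith [norm_nonneg T, norm_nonneg (T u), norm_nonneg (v - u)]
    rw [e]
    refine (abs_add_le _ _).trans ?_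
    have := abs_add_le (inner ℝ (T (v - u)) v) (inner ℝ (T u) (v - u))
    linarith [h u hu]
  linarith

lemma chernoff {E : Type*} [MeasurableSpace E] (μ : Measure E) [IsProbabilityMeasure μ] (g : E → ℝ)
    (hg : Measurable g) (b w l t : ℝ) (hb : ∀ᵐ x ∂μ, |g x| ≤ b) (h0 : ∫ x, g x ∂μ = 0)
    (hw : ∫ x, g x ^ 2 ∂μ ≤ w) (hl : 0 ≤ l) (hlb : l * b ≤ 1) (n : ℕ) :
    (Measure.pi fun _ : Fin n => μ).real {x | t ≤ ∑ i, g (x i)} ≤ exp (n * (l ^ 2 * w) - l * t) := by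
  have hgi : Integrable g μ := Integrable.of_bound hg.aestronglyMeasurable b hb
  have hgi2 : Integrable (fun x => g x ^ 2) μ := by
    refine Integrable.of_bound (hg.pow_const 2).aestronglyMeasurable (b ^ 2) ?_
    filter_upwards [hb] with x hx
    rw [norm_pow, Real.norm_eq_abs]
    exact pow_le_pow_left₀ (abs_nonneg _) hx 2
  have hei : Integrable (fun x => exp (l * g x)) μ := by
    refine Integrable.of_bound (by fun_prop) (exp 1) ?_
    filter_upwards [hb] with x hx
    rw [Real.norm_eq_abs, abs_of_pos (exp_pos _)]
    exact exp_le_exp.2 (by nlinarith [le_abs_self (g x)])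
  have h1 : ∫ x, exp (l * g x) ∂μ ≤ exp (l ^ 2 * w) := by
    have h2 : ∫ x, exp (l * g x) ∂μ ≤ ∫ x, (1 + l * g x + l ^ 2 * g x ^ 2) ∂μ := by
      refine integral_mono_ae hei (((integrable_const _).add (hgi.const_mul _)).add (hgi2.const_mul _)) ?_
      filter_upwards [hb] with x hx
      have h3 : |l * g x| ≤ 1 := by
        rw [abs_mul, abs_of_nonneg hl]
        exact (mul_le_mul_of_nonneg_left hx hl).trans hlb
      have h4 := (abs_le.1 (Real.abs_exp_sub_one_sub_id_le h3)).2
      change exp (l * g x) ≤ 1 + l * g x + l ^ 2 * g x ^ 2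
      nlinarith
    have h5 : ∫ x, (1 + l * g x + l ^ 2 * g x ^ 2) ∂μ = 1 + l ^ 2 * ∫ x, g x ^ 2 ∂μ := by
      rw [integral_add ((integrable_const _).fun_add (hgi.const_mul _)) (hgi2.const_mul _),
        integral_add (integrable_const _) (hgi.const_mul _), integral_const_mul, integral_const_mul, h0]
      simp
    rw [h5] at h2
    have h6 := add_one_le_exp (l ^ 2 * w)
    nlinarith [mul_le_mul_of_nonneg_left hw (sq_nonneg l)]
  set P := Measure.pi fun _ : Fin n => μ
  have hprod : ∫ x, exp (l * ∑ i, g (x i)) ∂P = (∫ x, exp (l * g x) ∂μ) ^ n := by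
    have := integral_fintype_prod_eq_pow (ι := Fin n) (fun x => exp (l * g x)) (μ := μ)
    rw [Fintype.card_fin] at this
    rw [← this]
    refine integral_congr_ae (Filter.Eventually.of_forall (fun x => ?_))
    simp only
    rw [Finset.mul_sum, exp_sum]
  have hI : Integrable (fun x : Fin n → E => exp (l * ∑ i, g (x i))) P := by
    have := Integrable.fintype_prod (ι := Fin n) (f := fun _ x => exp (l * g x)) (μ := fun _ => μ) (fun _ => hei)
    refine this.congr (Filter.Eventually.of_forall (fun x => ?_))
    simp only
    rw [Finset.mul_sum, exp_sum]
  have hM := mul_meas_ge_le_integral_of_nonneg (Filter.Eventually.of_forall (fun x => (exp_pos _).le)) hI (exp (l * t))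
  have hsub : P.real {x | t ≤ ∑ i, g (x i)} ≤ P.real {x | exp (l * t) ≤ exp (l * ∑ i, g (x i))} := by
    refine measureReal_mono (fun x hx => ?_)
    simp only [Set.mem_ofPred_eq] at hx ⊢
    exact exp_le_exp.2 (mul_le_mul_of_nonneg_left hx hl)
  rw [exp_sub, le_div_iff₀ (exp_pos _), mul_comm]
  refine (mul_le_mul_of_nonneg_left hsub (exp_pos _).le).trans (hM.trans ?_)
  rw [hprod]
  refine (pow_le_pow_left₀ (integral_nonneg (fun x => (exp_pos _).le)) h1 n).trans (le_of_eq ?_)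
  rw [← exp_nat_mul]

lemma frameOperator_continuous (d n : ℕ) :
    Continuous (fun x : Fin n → EU d => frameOperator x) := by
  unfold frameOperator
  refine continuous_finsetSum _ (fun i _ => ?_)
  have h1 : Continuous fun x : Fin n → EU d => innerSL ℝ (x i) :=
    (innerSL ℝ (E := EU d)).continuous.comp (continuous_apply i)
  have h2 : Continuous fun x : Fin n → EU d => x i := continuous_apply i
  exact (isBoundedBilinearMap_smulRight (𝕜 := ℝ) (E := EU d) (F := EU d)).continuous.comp (h1.prodMk h2)

lemma F_closed (d n : ℕ) (ε : ℝ) :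
    IsClosed {x : Fin n → EU d | ‖frameOperator x - 1‖ ≤ ε} :=
  isClosed_le ((frameOperator_continuous d n).sub continuous_const).norm continuous_const

set_option maxHeartbeats 2000000 in
lemma dir_tail {d n : ℕ} {ε : ℝ} (hd : 2 ≤ d) (hn : 1 ≤ n) (hε : 0 < ε) (hε1 : ε ≤ 0.28)
    (hbig : 35 * (d:ℝ) ^ 3 ≤ n * ε ^ 2) (m : ℝ)
    (hm : m = (∫ x, ‖x‖ ^ 2 ∂((volume : Measure (EU d))[|sphericalShell d n ε])) / d)
    (v : EU d) (hv : ‖v‖ = 1) :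
    (Measure.pi fun _ : Fin n => (volume : Measure (EU d))[|sphericalShell d n ε]).real
      {x | 2 * ε / (d + 2) ≤ |∑ i, (inner ℝ v (x i) ^ 2 - m)|} ≤ 2 * exp (- (3.5 * d)) := by
  set μ := (volume : Measure (EU d))[|sphericalShell d n ε] with hμ
  have : IsProbabilityMeasure μ := shell_prob (by omega) hn hε
  have hd0 : (2:ℝ) ≤ d := by exact_mod_cast hd
  have hn0 : (0:ℝ) < n := by exact_mod_cast hn
  set c := (d:ℝ)/n with hc
  have hc0 : 0 < c := by positivity
  have hM : ∀ᵐ x ∂μ, ‖x‖ ≤ √((1 + ε) * c) := by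
    filter_upwards [shell_ae d n ε] with x hx
    exact shell_norm_le hx
  have hsq : ∀ᵐ x ∂μ, ‖x‖ ^ 2 ≤ 1.28 * c := by
    filter_upwards [shell_ae d n ε] with x hx
    refine hx.2.trans ?_
    rw [← hc]; nlinarith
  have hI2 : Integrable (fun x : EU d => ‖x‖ ^ 2) μ := int_cont hM _ (by fun_prop)
  have hmean := abs_le.1 (shell_mean (d := d) (n := n) hd hn hε (by linarith))
  rw [← hμ, ← hc] at hmean
  have hE0 : 0 ≤ ∫ x, ‖x‖ ^ 2 ∂μ := integral_nonneg (fun x => by positivity)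
  have hE1 : ∫ x, ‖x‖ ^ 2 ∂μ ≤ 1.28 * c := by
    have h1 := integral_mono_ae hI2 (integrable_const (1.28 * c)) hsq
    simpa using h1
  have hm0 : 0 ≤ m := by rw [hm]; exact div_nonneg hE0 (by linarith)
  have hm1 : m ≤ 1.28 * c := by
    rw [hm, div_le_iff₀ (by linarith)]
    nlinarith
  set g : EU d → ℝ := fun x => inner ℝ v x ^ 2 - m with hg
  have hgc : Continuous g := by fun_prop
  have hgm : Measurable g := hgc.measurable
  have hinner : ∫ x, inner ℝ v x ^ 2 ∂μ = m := by
    have := mom2 (by omega) (shell_rot d n ε) (fun _ => 1) measurable_const (by simpa using hI2) v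
    simp only [one_mul, hv] at this
    rw [← hμ] at this
    rw [this, hm]; ring
  have i2 : Integrable (fun x => inner ℝ v x ^ 2) μ := int_cont hM _ (by fun_prop)
  have i4 : Integrable (fun x => inner ℝ v x ^ 4) μ := int_cont hM _ (by fun_prop)
  have hg0 : ∫ x, g x ∂μ = 0 := by
    simp only [hg]
    rw [integral_sub i2 (integrable_const _), hinner]; simp
  have hgb : ∀ᵐ x ∂μ, |g x| ≤ 1.28 * c := by
    filter_upwards [hsq] with x hx
    have h1 := abs_real_inner_le_norm v x
    rw [hv, one_mul] at h1
    have h2 : inner ℝ v x ^ 2 ≤ ‖x‖ ^ 2 := by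
      rw [← sq_abs]; exact pow_le_pow_left₀ (abs_nonneg _) h1 2
    simp only [hg]
    rw [abs_le]
    constructor <;> nlinarith [sq_nonneg (inner ℝ v x)]
  have hw : ∫ x, g x ^ 2 ∂μ ≤ 4.92 * d / ((d + 2) * n ^ 2) := by
    have e1 : ∫ x, g x ^ 2 ∂μ = ∫ x, inner ℝ v x ^ 4 ∂μ - m ^ 2 := by
      have : ∀ x, g x ^ 2 = inner ℝ v x ^ 4 - (2 * m * inner ℝ v x ^ 2 - m ^ 2) := by
        intro x; simp only [hg]; ring
      simp only [this]
      rw [integral_sub i4 (Integrable.sub' (i2.const_mul _) (integrable_const _)),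
        integral_sub (i2.const_mul _) (integrable_const _), integral_const_mul, hinner]
      simp; ring
    have e2 : ∫ x, ‖x‖ ^ 4 ∂μ ≤ (1.28 * c) ^ 2 := by
      have h1 : (fun x : EU d => ‖x‖ ^ 4) ≤ᵐ[μ] fun _ => (1.28 * c) ^ 2 := by
        filter_upwards [hsq] with x hx
        rw [show ‖x‖ ^ 4 = (‖x‖ ^ 2) ^ 2 by ring]
        exact pow_le_pow_left₀ (by positivity) hx 2
      have h2 := integral_mono_ae (int_cont hM _ (by fun_prop)) (integrable_const _) h1
      simpa using h2
    rw [e1, mom4 hM (by omega) (shell_rot d n ε) v hv]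
    have h3 : 3 / (d * ((d:ℝ) + 2)) * ∫ x, ‖x‖ ^ 4 ∂μ ≤ 3 / (d * ((d:ℝ) + 2)) * (1.28 * c) ^ 2 :=
      mul_le_mul_of_nonneg_left e2 (by positivity)
    have h4 : 3 / (d * ((d:ℝ) + 2)) * (1.28 * c) ^ 2 ≤ 4.92 * d / ((d + 2) * n ^ 2) := by
      have : 3 / (d * ((d:ℝ) + 2)) * (1.28 * c) ^ 2 = 4.9152 * d / ((d + 2) * n ^ 2) := by
        rw [hc]; field_simp; norm_num
      rw [this]; gcongr; norm_num
    linarith [sq_nonneg m]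
  set l := ε * n / (4.92 * d) with hl
  have hl0 : 0 ≤ l := by positivity
  have hlb : l * (1.28 * c) ≤ 1 := by
    have : l * (1.28 * c) = ε * 1.28 / 4.92 := by
      rw [hl, hc]; field_simp
    rw [this, div_le_one (by norm_num)]
    norm_num at hε1 ⊢
    linarith
  have hexp : n * (l ^ 2 * (4.92 * d / ((d + 2) * n ^ 2))) - l * (2 * ε / (d + 2)) ≤ - (3.5 * d) := by
    have : n * (l ^ 2 * (4.92 * d / ((d + 2) * n ^ 2))) - l * (2 * ε / (d + 2)) =
        - (n * ε ^ 2 / (4.92 * d * (d + 2))) := by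
      rw [hl]; field_simp; ring
    rw [this, neg_le_neg_iff, le_div_iff₀ (by positivity)]
    refine le_trans ?_ hbig
    nlinarith [mul_pos (by linarith : (0:ℝ) < d) (by linarith : (0:ℝ) < d), mul_nonneg (by positivity : (0:ℝ) ≤ d ^ 2) (by linarith : (0:ℝ) ≤ d - 2)]
  have c1 := chernoff μ g hgm _ _ l (2 * ε / (d + 2)) hgb hg0 hw hl0 hlb n
  have c2 := chernoff μ (fun x => - g x) hgm.neg _ _ l (2 * ε / (d + 2)) (by simpa using hgb)
    (by rw [integral_neg, hg0, neg_zero]) (by simpa using hw) hl0 hlb n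
  set P := Measure.pi fun _ : Fin n => μ
  have hsub : {x : Fin n → EU d | 2 * ε / (d + 2) ≤ |∑ i, (inner ℝ v (x i) ^ 2 - m)|} ⊆
      {x | 2 * ε / (d + 2) ≤ ∑ i, g (x i)} ∪ {x | 2 * ε / (d + 2) ≤ ∑ i, - g (x i)} := by
    intro x hx
    rcases le_abs.1 (show 2 * ε / (d + 2) ≤ |∑ i, g (x i)| from hx) with h | h
    · exact Or.inl h
    · refine Or.inr ?_
      simpa [Finset.sum_neg_distrib] using h
  calc P.real _ ≤ _ := measureReal_mono hsub (measure_ne_top _ _)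
    _ ≤ _ := measureReal_union_le _ _
    _ ≤ exp (-(3.5 * d)) + exp (-(3.5 * d)) :=
        add_le_add (c1.trans (exp_le_exp.2 hexp)) (c2.trans (exp_le_exp.2 hexp))
    _ = _ := by ring

set_option maxHeartbeats 1000000 in
lemma PF_half {d n : ℕ} {ε : ℝ} (hd : 2 ≤ d) (hn : 1 ≤ n) (hε : 0 < ε) (hε1 : ε ≤ 0.28)
    (hbig : 35 * (d:ℝ) ^ 3 ≤ n * ε ^ 2) :
    1 / 2 ≤ (Measure.pi fun _ : Fin n => (volume : Measure (EU d))[|sphericalShell d n ε]).real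
      {x | ‖frameOperator x - 1‖ ≤ ε} := by
  have : IsProbabilityMeasure ((volume : Measure (EU d))[|sphericalShell d n ε]) := shell_prob (by omega) hn hε
  set P := Measure.pi fun _ : Fin n => (volume : Measure (EU d))[|sphericalShell d n ε] with hP
  have hPp : IsProbabilityMeasure P := by rw [hP]; infer_instance
  have hd0 : (2:ℝ) ≤ d := by exact_mod_cast hd
  have hn0 : (0:ℝ) < n := by exact_mod_cast hn
  obtain ⟨N, hN1, hNc, hN⟩ := exists_net d
  set m := (∫ x, ‖x‖ ^ 2 ∂((volume : Measure (EU d))[|sphericalShell d n ε])) / d with hm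
  have hnm : |n * m - 1| ≤ ε - 4 * ε / (d + 2) := by
    have h := shell_mean (d := d) (n := n) hd hn hε (by linarith)
    have e : n * m - 1 = (n / d : ℝ) * (∫ x, ‖x‖ ^ 2 ∂((volume : Measure (EU d))[|sphericalShell d n ε]) - (d:ℝ)/n) := by
      rw [hm]; field_simp
    rw [e, abs_mul, abs_of_pos (by positivity : (0:ℝ) < n / d)]
    refine (mul_le_mul_of_nonneg_left h (by positivity)).trans (le_of_eq ?_)
    field_simp
  have hsub : {x : Fin n → EU d | ‖frameOperator x - 1‖ ≤ ε}ᶜ ⊆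
      ⋃ v ∈ N, {x | 2 * ε / (d + 2) ≤ |∑ i, (inner ℝ v (x i) ^ 2 - m)|} := by
    intro x hx
    by_contra hcon
    apply hx
    simp only [Set.mem_iUnion, Set.mem_ofPred_eq, not_exists, not_le] at hcon ⊢
    set T : EU d →L[ℝ] EU d := frameOperator x - (n * m) • 1 with hT
    have hTin : ∀ u w, inner ℝ (T u) w = ∑ i, inner ℝ (x i) u * inner ℝ (x i) w - n * m * inner ℝ u w := by
      intro u w
      rw [hT, ContinuousLinearMap.sub_apply, inner_sub_left, frameOperator_inner]
      simp [inner_smul_left]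
    have hTs : (T : EU d →ₗ[ℝ] EU d).IsSymmetric := by
      intro u w
      change inner ℝ (T u) w = inner ℝ u (T w)
      rw [hTin, real_inner_comm (T w) u, hTin, real_inner_comm u w]
      congr 1
      exact Finset.sum_congr rfl (fun i _ => by ring)
    have h1 := net_norm N hN1 hN T hTs (2 * ε / (d + 2)) (by positivity) (fun v hv => by
      refine le_trans (le_of_eq ?_) (hcon v hv).le
      rw [hTin, Finset.sum_sub_distrib, real_inner_self_eq_norm_sq, hN1 v hv]
      congr 1
      simp only [Finset.sum_const, Finset.card_univ, Fintype.card_fin, nsmul_eq_mul]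
      rw [one_pow, mul_one]
      congr 1
      exact Finset.sum_congr rfl (fun i _ => by rw [real_inner_comm]; ring))
    have h2 : frameOperator x - 1 = T + (n * m - 1) • (1 : EU d →L[ℝ] EU d) := by
      have hs : (n * m - 1) • (1 : EU d →L[ℝ] EU d) = (n * m) • (1 : EU d →L[ℝ] EU d) - 1 := by
        ext u; simp [sub_mul]
      rw [hT, hs]; abel
    rw [h2]
    refine (norm_add_le _ _).trans ?_
    have h3 : ‖(n * m - 1) • (1 : EU d →L[ℝ] EU d)‖ ≤ ε - 4 * ε / (d + 2) := by
      rw [norm_smul, Real.norm_eq_abs]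
      have h4 : ‖(1 : EU d →L[ℝ] EU d)‖ ≤ 1 := ContinuousLinearMap.norm_id_le
      exact (mul_le_of_le_one_right (abs_nonneg _) h4).trans hnm
    have h5 : 2 * (2 * ε / (d + 2)) = 4 * ε / (d + 2) := by ring
    linarith
  have hbad : P.real {x : Fin n → EU d | ‖frameOperator x - 1‖ ≤ ε}ᶜ ≤ 1 / 2 := by
    calc P.real _ ≤ P.real (⋃ v ∈ N, {x | 2 * ε / (d + 2) ≤ |∑ i, (inner ℝ v (x i) ^ 2 - m)|}) :=
          measureReal_mono hsub (measure_ne_top _ _)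
      _ ≤ ∑ v ∈ N, P.real {x | 2 * ε / (d + 2) ≤ |∑ i, (inner ℝ v (x i) ^ 2 - m)|} :=
          measureReal_biUnion_finset_le _ _
      _ ≤ ∑ v ∈ N, 2 * exp (- (3.5 * d)) :=
          Finset.sum_le_sum (fun v hv => dir_tail hd hn hε hε1 hbig m hm v (hN1 v hv))
      _ ≤ 9 ^ d * (2 * exp (- (3.5 * d))) := by
          rw [Finset.sum_const, nsmul_eq_mul]
          refine mul_le_mul_of_nonneg_right ?_ (by positivity)
          exact_mod_cast hNc
      _ = 2 * (9 * exp (-3.5)) ^ d := by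
          rw [mul_pow, ← exp_nat_mul]
          ring_nf
      _ ≤ 2 * (1 / 2) ^ d := by
          gcongr
          have h1 : (18:ℝ) ≤ exp 3.5 := by
            have h2 := Real.exp_one_gt_d9
            have h3 : exp 3 = exp 1 ^ 3 := by rw [← exp_nat_mul]; norm_num
            have h4 : exp 3 ≤ exp 3.5 := exp_le_exp.2 (by norm_num)
            have h5 : (2.7:ℝ) ^ 3 ≤ exp 1 ^ 3 := pow_le_pow_left₀ (by norm_num) (by linarith) 3
            norm_num at h5
            linarith
          rw [exp_neg, ← div_eq_mul_inv, div_le_div_iff₀ (exp_pos _) (by norm_num)]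
          linarith
      _ ≤ 2 * (1 / 2) ^ 2 := by
          have := pow_le_pow_of_le_one (by norm_num : (0:ℝ) ≤ 1/2) (by norm_num) hd
          linarith
      _ = 1 / 2 := by norm_num
  rw [probReal_compl_eq_one_sub (F_closed d n ε).measurableSet] at hbad
  linarith

lemma det_cont {d n : ℕ} (f : Fin d → Fin n) :
    Continuous (fun x : Fin n → EU d => (stdB d).det (x ∘ f)) := by
  simp only [Module.Basis.det_apply]
  refine Continuous.matrix_det ?_
  refine continuous_matrix (fun i j => ?_)
  simp only [Module.Basis.toMatrix_apply, Function.comp]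
  have h := LinearMap.continuous_of_finiteDimensional ((stdB d).coord i)
  exact h.comp (continuous_apply (f j))

lemma det_null {d n : ℕ} (f : Fin d → Fin n) (hf : Function.Injective f) :
    ∀ᵐ x ∂(volume : Measure (Fin n → EU d)), x ∈ {x : Fin n → EU d | (stdB d).det (x ∘ f) ≠ 0} := by
  have : (volume : Measure (Fin n → EU d)).IsAddHaarMeasure := by
    rw [volume_pi]; infer_instance
  refine ae_mem_of_ae_add_linearMap_mem
    (LinearMap.toSpanSingleton ℝ (Fin n → EU d) (Function.extend f (stdB d) 0))
    (volume : Measure ℝ) _ (isOpen_ne_fun (det_cont f) continuous_const).measurableSet ?_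
  intro y
  set A := (stdB d).toMatrix (y ∘ f) with hA
  have key : ∀ t : ℝ, (stdB d).det ((y + LinearMap.toSpanSingleton ℝ (Fin n → EU d) (Function.extend f (stdB d) 0) t) ∘ f)
      = (-A).charpoly.eval t := by
    intro t
    rw [Matrix.eval_charpoly, Module.Basis.det_apply]
    congr 1
    ext i j
    simp [Module.Basis.toMatrix_apply, hA, hf.extend_apply, Matrix.one_apply, Finsupp.single_apply, Matrix.diagonal_apply, eq_comm]
    ring_nf
  have hfin : {t : ℝ | (-A).charpoly.eval t = 0}.Finite := by
    have h := Polynomial.finite_setOf_isRoot ((-A).charpoly_monic.ne_zero)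
    exact h
  have := hfin.measure_zero (volume : Measure ℝ)
  rw [ae_iff]
  refine measure_mono_null ?_ this
  intro t ht
  simp only [Set.mem_ofPred_eq, not_not, ne_eq] at ht ⊢
  rw [← key t]; exact ht

lemma genPos_vol (d n : ℕ) : ∀ᵐ x ∂(volume : Measure (Fin n → EU d)), GenPos x := by
  unfold GenPos
  rw [ae_all_iff]; intro f
  by_cases hf : Function.Injective f
  · filter_upwards [det_null f hf] with x hx _ using hx
  · exact Filter.Eventually.of_forall (fun x h => absurd h hf)

lemma pi_shell_ac {d n : ℕ} {ε : ℝ} (hd : 1 ≤ d) (hn : 1 ≤ n) (hε : 0 < ε) :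
    (Measure.pi fun _ : Fin n => (volume : Measure (EU d))[|sphericalShell d n ε]) =
      ((volume (sphericalShell d n ε))⁻¹ ^ n) •
        (volume : Measure (Fin n → EU d)).restrict (Set.univ.pi fun _ => sphericalShell d n ε) := by
  have : IsProbabilityMeasure ((volume : Measure (EU d))[|sphericalShell d n ε]) := shell_prob hd hn hε
  rw [volume_pi, Measure.restrict_pi_pi]
  refine Measure.pi_eq (fun s hs => ?_)
  simp only [ProbabilityTheory.cond, Measure.smul_apply, smul_eq_mul, Measure.pi_pi, Finset.prod_mul_distrib, Finset.prod_const, Finset.card_univ, Fintype.card_fin]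

lemma genPos_shell {d n : ℕ} {ε : ℝ} (hd : 1 ≤ d) (hn : 1 ≤ n) (hε : 0 < ε) :
    ∀ᵐ x ∂(Measure.pi fun _ : Fin n => (volume : Measure (EU d))[|sphericalShell d n ε]),
      GenPos x ∧ ∀ i, x i ∈ sphericalShell d n ε := by
  have : IsProbabilityMeasure ((volume : Measure (EU d))[|sphericalShell d n ε]) := shell_prob hd hn hε
  refine Filter.Eventually.and ?_ ?_
  · rw [pi_shell_ac hd hn hε]
    refine Measure.ae_smul_measure ?_ _
    exact ae_restrict_of_ae (genPos_vol d n)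
  · rw [ae_all_iff]; intro i
    exact Measure.tendsto_eval_ae_ae.eventually (shell_ae d n ε)

lemma paulsen_le {d n : ℕ} (x y : Fin n → EU d) (hy : y ∈ equalNormParseval d n) :
    paulsenDistSq x ≤ ∑ i, ‖x i - y i‖ ^ 2 := by
  unfold paulsenDistSq
  refine ciInf_le (f := fun y : equalNormParseval d n => ∑ i, ‖x i - (y : Fin n → EU d) i‖ ^ 2) ⟨0, ?_⟩ ⟨y, hy⟩
  rintro _ ⟨z, rfl⟩
  exact Finset.sum_nonneg (fun i _ => by positivity)

lemma neg_mem_enp {d n : ℕ} {y : Fin n → EU d} (hy : y ∈ equalNormParseval d n) :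
    (fun i => - y i) ∈ equalNormParseval d n := by
  refine ⟨?_, fun i => by rw [norm_neg]; exact hy.2 i⟩
  rw [← hy.1]
  unfold frameOperator
  refine Finset.sum_congr rfl (fun i _ => ?_)
  ext1 u
  simp

lemma sqrt_const : (25:ℝ) ≤ (√20 + √2) ^ 2 ∧ 34.6 ≤ (√20 + √2) ^ 2 := by
  have h1 : √20 ^ 2 = (20:ℝ) := Real.sq_sqrt (by norm_num)
  have h2 : √2 ^ 2 = (2:ℝ) := Real.sq_sqrt (by norm_num)
  have h3 : (4.47:ℝ) ≤ √20 := Real.le_sqrt_of_sq_le (by norm_num)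
  have h4 : (1.414:ℝ) ≤ √2 := Real.le_sqrt_of_sq_le (by norm_num)
  constructor <;> nlinarith

/-- trivial bound by the diameter -/
lemma trivial_bound {d n : ℕ} {ε : ℝ} (hn : 1 ≤ n) (y : Fin n → EU d)
    (hy : y ∈ equalNormParseval d n) (x : Fin n → EU d) (hx : ∀ i, x i ∈ sphericalShell d n ε) :
    paulsenDistSq x ≤ (2 + ε) * d := by
  have hn0 : (0:ℝ) < n := by exact_mod_cast hn
  have main : ∀ z ∈ equalNormParseval d n, 0 ≤ ∑ i, inner ℝ (x i) (z i) → paulsenDistSq x ≤ (2 + ε) * d := by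
    intro z hz hpos
    refine (paulsen_le x z hz).trans ?_
    simp only [norm_sub_sq_real]
    rw [Finset.sum_add_distrib, Finset.sum_sub_distrib, ← Finset.mul_sum]
    have h1 : ∑ i, ‖x i‖ ^ 2 ≤ ∑ i : Fin n, (1 + ε) * ((d:ℝ) / n) :=
      Finset.sum_le_sum (fun i _ => (hx i).2)
    have h2 : ∑ i, ‖z i‖ ^ 2 = ∑ i : Fin n, ((d:ℝ) / n) :=
      Finset.sum_congr rfl (fun i _ => hz.2 i)
    simp only [Finset.sum_const, Finset.card_univ, Fintype.card_fin, nsmul_eq_mul] at h1 h2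
    have h3 : (n:ℝ) * ((1 + ε) * ((d:ℝ) / n)) = (1 + ε) * d := by field_simp
    have h4 : (n:ℝ) * ((d:ℝ) / n) = d := by field_simp
    rw [h3] at h1; rw [h4] at h2
    rw [h2]
    linarith
  rcases le_total 0 (∑ i, inner ℝ (x i) (y i)) with h | h
  · exact main y hy h
  · refine main _ (neg_mem_enp hy) ?_
    simp only [inner_neg_right, Finset.sum_neg_distrib]
    linarith

lemma enp_nonempty {d n : ℕ} (hd : 1 ≤ d) (hn : d + 1 ≤ n) : ∃ y, y ∈ equalNormParseval d n := by
  have : IsProbabilityMeasure ((volume : Measure (EU d))[|sphericalShell d n (1/2)]) :=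
    shell_prob hd (by omega) (by norm_num)
  obtain ⟨x, hx, hs⟩ := (genPos_shell (d := d) (n := n) (ε := 1/2) hd (by omega) (by norm_num)).exists
  obtain ⟨y, hy, -⟩ := dist_scaling hd hn x hx
    (fun i => shell_ne_zero hd (by omega) (by norm_num) (hs i))
  exact ⟨y, hy⟩

lemma PF_pos {d n : ℕ} {ε : ℝ} (hd : 1 ≤ d) (hn : d + 1 ≤ n) (hε : 0 < ε) :
    (Measure.pi fun _ : Fin n => (volume : Measure (EU d))[|sphericalShell d n ε])
      {x | ‖frameOperator x - 1‖ ≤ ε} ≠ 0 := by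
  obtain ⟨y, hy⟩ := enp_nonempty hd hn
  set U : Set (Fin n → EU d) := {x | ‖frameOperator x - 1‖ < ε} ∩ Set.univ.pi (fun _ => openShell d n ε) with hU
  have hUo : IsOpen U := by
    refine IsOpen.inter (isOpen_lt ((frameOperator_continuous d n).sub continuous_const).norm continuous_const) ?_
    exact isOpen_set_pi Set.finite_univ (fun i _ => openShell_open d n ε)
  have hyU : y ∈ U := by
    refine ⟨?_, fun i _ => mem_openShell hd (by omega) hε (hy.2 i)⟩
    change ‖frameOperator y - 1‖ < ε
    rw [hy.1, sub_self, norm_zero]; exact hε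
  have hvol : (volume : Measure (Fin n → EU d)) U ≠ 0 := (hUo.measure_pos volume ⟨y, hyU⟩).ne'
  intro h0
  have h1 : (Measure.pi fun _ : Fin n => (volume : Measure (EU d))[|sphericalShell d n ε]) U = 0 :=
    measure_mono_null (fun x hx => (show ‖frameOperator x - 1‖ ≤ ε from (show ‖frameOperator x - 1‖ < ε from hx.1).le)) h0
  rw [pi_shell_ac hd (by omega) hε, Measure.smul_apply, smul_eq_mul,
    Measure.restrict_apply hUo.measurableSet] at h1
  have hsub : U ⊆ Set.univ.pi fun _ => sphericalShell d n ε :=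
    fun x hx i hi => openShell_sub d n ε (hx.2 i hi)
  rw [Set.inter_eq_self_of_subset_left hsub] at h1
  rcases mul_eq_zero.1 h1 with h | h
  · have := pow_eq_zero_iff (by omega : n ≠ 0) |>.1 h
    exact shell_vol_ne_top d n ε (ENNReal.inv_eq_zero.1 this)
  · exact hvol h

lemma l2_triangle {d n : ℕ} (x w y : Fin n → EU d) (a b : ℝ) (ha : 0 ≤ a) (hb : 0 ≤ b)
    (h1 : ∑ i, ‖x i - w i‖ ^ 2 ≤ a ^ 2) (h2 : ∑ i, ‖w i - y i‖ ^ 2 ≤ b ^ 2) :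
    ∑ i, ‖x i - y i‖ ^ 2 ≤ (a + b) ^ 2 := by
  let X : (Fin n → EU d) → PiLp 2 (fun _ : Fin n => EU d) := fun x => WithLp.toLp 2 x
  have hN : ∀ u v : Fin n → EU d, ‖X u - X v‖ ^ 2 = ∑ i, ‖u i - v i‖ ^ 2 := by
    intro u v
    rw [PiLp.norm_sq_eq_of_L2]; rfl
  rw [← hN] at h1 h2 ⊢
  have h1' := abs_le_of_sq_le_sq h1 ha
  have h2' := abs_le_of_sq_le_sq h2 hb
  have h3 := norm_sub_le_norm_sub_add_norm_sub (X x) (X w) (X y)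
  refine pow_le_pow_left₀ (norm_nonneg _) ?_ 2
  linarith [le_abs_self ‖X x - X w‖, le_abs_self ‖X w - X y‖]

lemma shell_normalize {d n : ℕ} {ε : ℝ} (hd : 1 ≤ d) (hn : 1 ≤ n) (hε : 0 < ε) (hε1 : ε < 1)
    (x : Fin n → EU d) (hx : ∀ i, x i ∈ sphericalShell d n ε) :
    ∑ i, ‖x i - (√((d:ℝ)/n)/‖x i‖) • x i‖ ^ 2 ≤ (ε * √d) ^ 2 := by
  have hn0 : (0:ℝ) < n := by exact_mod_cast hn
  have hd0 : (0:ℝ) < d := by exact_mod_cast hd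
  have hb : ∀ i, ‖x i - (√((d:ℝ)/n)/‖x i‖) • x i‖ ^ 2 ≤ ε ^ 2 * ((d:ℝ)/n) := by
    intro i
    have hr : 0 < ‖x i‖ := norm_pos_iff.2 (shell_ne_zero hd hn hε1 (hx i))
    set c := (d:ℝ)/n with hc
    have hc0 : 0 < c := by positivity
    have hs : √c ^ 2 = c := Real.sq_sqrt hc0.le
    have hs0 : 0 < √c := Real.sqrt_pos.2 hc0
    have e : x i - (√c/‖x i‖) • x i = ((‖x i‖ - √c) / ‖x i‖) • x i := by
      rw [sub_div, div_self hr.ne', sub_smul, one_smul]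
    rw [e, norm_smul, Real.norm_eq_abs, mul_pow, sq_abs, div_pow, div_mul_cancel₀ _ (by positivity)]
    obtain ⟨l, u⟩ := hx i
    rw [← hc] at l u
    rw [← hs] at l u
    have h1 : ‖x i‖ - √c ≤ ε * √c := by
      by_contra hcon
      push Not at hcon
      nlinarith [mul_pos hε hs0]
    have h2 : -(ε * √c) ≤ ‖x i‖ - √c := by
      by_contra hcon
      push Not at hcon
      nlinarith [mul_pos hε hs0]
    calc (‖x i‖ - √c) ^ 2 ≤ (ε * √c) ^ 2 := sq_le_sq' h2 h1
      _ = ε ^ 2 * c := by rw [mul_pow, hs]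
  refine (Finset.sum_le_sum (fun i _ => hb i)).trans (le_of_eq ?_)
  simp only [Finset.sum_const, Finset.card_univ, Fintype.card_fin, nsmul_eq_mul]
  rw [mul_pow, Real.sq_sqrt hd0.le]
  field_simp

lemma good_bound {d n : ℕ} {ε : ℝ} (hd : 1 ≤ d) (hn : d + 1 ≤ n) (hε : 0 < ε) (hε1 : ε < 1)
    (x : Fin n → EU d) (hx : ∀ i, x i ∈ sphericalShell d n ε) (hg : GenPos x)
    (hX : ‖∑ i, XV d n (x i)‖ ≤ 8 * ε ^ 2 / √d) :
    paulsenDistSq x ≤ (√20 + √2) ^ 2 * ε ^ 2 * d := by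
  have hd0 : (0:ℝ) < d := by exact_mod_cast hd
  obtain ⟨y, hy, hb⟩ := dist_scaling hd hn x hg (fun i => shell_ne_zero hd (by omega) hε1 (hx i))
  have hsd : √(d:ℝ) ^ 2 = d := Real.sq_sqrt hd0.le
  have hsd0 : 0 < √(d:ℝ) := Real.sqrt_pos.2 hd0
  have h2 : ∑ i, ‖(√((d:ℝ)/n)/‖x i‖) • x i - y i‖^2 ≤ (4 * ε * √d) ^ 2 := by
    refine hb.trans ((mul_le_mul_of_nonneg_left hX (by positivity)).trans (le_of_eq ?_))
    rw [mul_pow, hsd]; field_simp; ring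
  have h3 := l2_triangle x (fun i => (√((d:ℝ)/n)/‖x i‖) • x i) y (ε * √d) (4 * ε * √d) (by positivity) (by positivity)
    (shell_normalize hd (by omega) hε hε1 x hx) h2
  refine (paulsen_le x y hy).trans (h3.trans ?_)
  have : (ε * √d + 4 * ε * √d) ^ 2 = 25 * (ε ^ 2 * d) := by
    rw [show ε * √d + 4 * ε * √d = 5 * ε * √d by ring, mul_pow, hsd]; ring
  rw [this, mul_assoc]
  exact mul_le_mul_of_nonneg_right sqrt_const.1 (by positivity)

lemma large_n {d n : ℕ} {ε : ℝ} (hd : 2 ≤ d)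
    (hA : 2 * d * Real.exp (-(n * ε ^ 4) / (2 * d ^ 3)) < 1) :
    2.76 * (d:ℝ) ^ 3 ≤ n * ε ^ 4 := by
  have hd0 : (2:ℝ) ≤ d := by exact_mod_cast hd
  have hd3 : (0:ℝ) < (d:ℝ) ^ 3 := by positivity
  set K := (n * ε ^ 4) / (2 * (d:ℝ) ^ 3) with hK
  have h1 : -(n * ε ^ 4) / (2 * (d:ℝ) ^ 3) = -K := by rw [hK]; ring
  rw [h1, Real.exp_neg, ← div_eq_mul_inv, div_lt_one (Real.exp_pos _)] at hA
  have h2 : (4:ℝ) < exp K := by linarith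
  have h3 : Real.log 4 < K := (Real.log_lt_iff_lt_exp (by norm_num)).2 h2
  have h4 : Real.log 4 = 2 * Real.log 2 := by
    rw [show (4:ℝ) = 2 ^ 2 by norm_num, Real.log_pow]; norm_num
  have h5 := Real.log_two_gt_d9
  have h6 : 1.38 ≤ K := by norm_num at h5 ⊢; linarith
  rw [hK, le_div_iff₀ (by positivity)] at h6
  norm_num at h6 ⊢; linarith

/-- **Concentration for the Paulsen problem.**
Let `ε ∈ (0,1)` and let `(x_i)` be drawn from the uniform measure `ν` on `ℱ_{d,n}^ε`,
i.e. the `n`-fold product of the uniform measure on the shell `S_ε^d`, conditioned on the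
event that `(x_i)` is ε-nearly Parseval. Then, with probability at least
`1 - (2d·exp(-nε⁴/(2d³))) / (1 - 2d·exp(-6ε²n/(5(d+2)²)))`, one has
`inf_{(y_i) ∈ ℱ_{d,n}} ∑ i ‖x_i - y_i‖² ≤ (√20 + √2)²·ε²·d`. -/
theorem paulsen_concentration
    (d n : ℕ) (hd : 2 ≤ d) (hn : 1 ≤ n) (ε : ℝ) (hε : ε ∈ Set.Ioo (0 : ℝ) 1)
    (hbig : 2 * d * Real.exp (-(6 * ε ^ 2 * n) / (5 * (d + 2) ^ 2)) < 1) :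
    ((Measure.pi fun _ : Fin n =>
        (volume : Measure (EuclideanSpace ℝ (Fin d)))[|sphericalShell d n ε])[|
          {x | ‖frameOperator x - 1‖ ≤ ε}])
        {x | paulsenDistSq x ≤ (Real.sqrt 20 + Real.sqrt 2) ^ 2 * ε ^ 2 * d}
      ≥ ENNReal.ofReal
          (1 - (2 * d * Real.exp (-(n * ε ^ 4) / (2 * d ^ 3))) /
            (1 - 2 * d * Real.exp (-(6 * ε ^ 2 * n) / (5 * (d + 2) ^ 2)))) := by
  obtain ⟨hε0, hε1⟩ := hε
  have hd0 : (2:ℝ) ≤ d := by exact_mod_cast hd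
  have hn0 : (0:ℝ) < n := by exact_mod_cast hn
  set B := 2 * d * Real.exp (-(6 * ε ^ 2 * n) / (5 * (d + 2) ^ 2)) with hB
  have hB0 : 0 ≤ B := by positivity
  set A := 2 * d * Real.exp (-(n * ε ^ 4) / (2 * d ^ 3)) with hAdef
  have hA0 : 0 ≤ A := by positivity
  have hAB : A ≤ A / (1 - B) := by
    rw [le_div_iff₀ (by linarith)]
    nlinarith
  refine ge_iff_le.2 (le_trans (ENNReal.ofReal_le_ofReal (sub_le_sub_left hAB 1)) ?_)
  rcases le_or_gt 1 A with hA | hA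
  · rw [ENNReal.ofReal_of_nonpos (by linarith)]; exact zero_le
  have hL := large_n hd hA
  have hε4 : ε ^ 4 ≤ 1 := pow_le_one₀ hε0.le hε1.le
  have hnd : d + 1 ≤ n := by
    have h1 : (d:ℝ) + 1 ≤ n := by
      have : 2.76 * (d:ℝ) ^ 3 ≤ n := hL.trans (mul_le_of_le_one_right hn0.le hε4)
      have h2 : (d:ℝ) ^ 3 = d * (d * d) := by ring
      norm_num at this
      nlinarith
    exact_mod_cast h1
  have hprob : IsProbabilityMeasure ((volume : Measure (EU d))[|sphericalShell d n ε]) :=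
    shell_prob (by omega) hn hε0
  have hgp := genPos_shell (d := d) (n := n) (ε := ε) (by omega) hn hε0
  have hFpos := PF_pos (d := d) (n := n) (ε := ε) (by omega) hnd hε0
  have hft := frob_tail (d := d) (n := n) hd hn hε0 hε1 (8 * ε ^ 2 / √d) (by positivity)
  have hhalf := fun h1 h2 => PF_half (d := d) (n := n) (ε := ε) hd hn hε0 h1 h2
  have hPp : IsProbabilityMeasure (Measure.pi fun _ : Fin n => (volume : Measure (EU d))[|sphericalShell d n ε]) := inferInstance
  generalize (Measure.pi fun _ : Fin n => (volume : Measure (EU d))[|sphericalShell d n ε]) = P at *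
  have hFm : MeasurableSet {x : Fin n → EU d | ‖frameOperator x - 1‖ ≤ ε} := (F_closed d n ε).measurableSet
  set F := {x : Fin n → EU d | ‖frameOperator x - 1‖ ≤ ε} with hF
  have hQ : IsProbabilityMeasure (P[|F]) := cond_isProbabilityMeasure hFpos
  have hac : P[|F] ≪ P := cond_absolutelyContinuous
  have hgpQ := hac.ae_le hgp
  rcases le_or_gt 0.28 ε with hbe | hse
  · obtain ⟨y, hy⟩ := enp_nonempty (d := d) (n := n) (by omega) hnd
    have : ∀ᵐ x ∂P[|F], x ∈ {x | paulsenDistSq x ≤ (√20 + √2) ^ 2 * ε ^ 2 * d} := by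
      filter_upwards [hgpQ] with x hx
      refine (trivial_bound hn y hy x hx.2).trans ?_
      refine mul_le_mul_of_nonneg_right ?_ (by positivity)
      refine le_trans ?_ (mul_le_mul_of_nonneg_right sqrt_const.2 (sq_nonneg ε))
      norm_num at hbe ⊢
      nlinarith
    rw [measure_eq_measure_of_null_diff (Set.subset_univ _) (by simpa [Set.compl_eq_univ_diff] using mem_ae_iff.1 this), measure_univ]
    exact ENNReal.ofReal_le_one.2 (by linarith)
  · have h35 : 35 * (d:ℝ) ^ 3 ≤ n * ε ^ 2 := by
      have h1 : ε ^ 2 ≤ 0.0784 := by norm_num at hse ⊢; nlinarith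
      have h2 : n * ε ^ 4 ≤ n * ε ^ 2 * 0.0784 := by
        rw [show n * ε ^ 4 = n * ε ^ 2 * ε ^ 2 by ring]
        exact mul_le_mul_of_nonneg_left h1 (by positivity)
      have h3 : 2.76 * (d:ℝ) ^ 3 ≤ n * ε ^ 2 * 0.0784 := hL.trans h2
      have h4 : (0:ℝ) ≤ (d:ℝ) ^ 3 := by positivity
      norm_num at h3 ⊢
      linarith
    have hPF := hhalf hse.le h35
    set Bad := {x : Fin n → EU d | 8 * ε ^ 2 / √d ≤ ‖∑ i, XV d n (x i)‖} with hBad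
    have hBm : MeasurableSet Bad := by
      refine measurableSet_le measurable_const ?_
      refine Measurable.norm (Finset.measurable_sum _ (fun i _ => ?_))
      exact (XV_measurable d n).comp (measurable_pi_apply i)
    have hle : (Badᶜ : Set (Fin n → EU d)) ≤ᵐ[P[|F]] {x | paulsenDistSq x ≤ (√20 + √2) ^ 2 * ε ^ 2 * d} := by
      filter_upwards [hgpQ] with x hx hxB
      refine good_bound (by omega) hnd hε0 hε1 x hx.2 hx.1 ?_
      have hxB' : ¬ (8 * ε ^ 2 / √d ≤ ‖∑ i, XV d n (x i)‖) := hxB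
      exact (not_le.1 hxB').le
    refine le_trans ?_ (measure_mono_ae hle)
    rw [ENNReal.ofReal_le_iff_le_toReal (measure_ne_top _ _)]
    change _ ≤ (P[|F]).real Badᶜ
    rw [probReal_compl_eq_one_sub hBm]
    have hQB : (P[|F]).real Bad ≤ 2 * P.real Bad := by
      have h0 : (P[|F]).real Bad = (P.real F)⁻¹ * P.real (F ∩ Bad) := by
        simp only [Measure.real]
        rw [cond_apply hFm, ENNReal.toReal_mul, ENNReal.toReal_inv]
      rw [h0]
      have h1 : P.real (F ∩ Bad) ≤ P.real Bad := measureReal_mono Set.inter_subset_right (measure_ne_top _ _)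
      have h2 : (P.real F)⁻¹ ≤ 2 := by
        rw [inv_le_comm₀ (by linarith) (by norm_num)]; linarith
      exact mul_le_mul h2 h1 measureReal_nonneg (by norm_num)
    have hexp : exp (-(n * (8 * ε ^ 2 / √d) ^ 2 / (2 * (d:ℝ) ^ 2))) ≤ exp (-(n * ε ^ 4) / (2 * d ^ 3)) := by
      rw [Real.exp_le_exp]
      rw [div_pow, Real.sq_sqrt (by positivity)]
      have h1 : n * ((8 * ε ^ 2) ^ 2 / (d:ℝ)) / (2 * (d:ℝ) ^ 2) = 64 * (n * ε ^ 4 / (2 * d ^ 3)) := by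
        field_simp; ring
      have h2 : 0 ≤ n * ε ^ 4 / (2 * (d:ℝ) ^ 3) := by positivity
      rw [h1, neg_div]; linarith
    have hE0 := (Real.exp_pos (-(n * ε ^ 4) / (2 * (d:ℝ) ^ 3))).le
    have : A = 2 * d * exp (-(n * ε ^ 4) / (2 * (d:ℝ) ^ 3)) := hAdef
    nlinarith
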